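/- arXiv:2106.09796 — 2 statements merged into one kernel-verified Lean document; each statement's English description precedes it below -/
import Mathlib

section
/- (Hellus–Stückrad) Let (A,m) be a complete commutative Noetherian local ring, let 𝔞 be an ideal of A, and suppose there is an integer c such that H^i_𝔞(A) = 0 for all i ≠ c and H^c_𝔞(A) ≠ 0. Then the natural ring homomorphism A → End_A(H^c_𝔞(A)), sending a ∈ A to multiplication by a, is an isomorphism. In particular, no nonzero element of A annihilates H^c_𝔞(A). -/
open CategoryTheory

namespace HellusStuckrad

section Derived

open Limits Triangulated Pretriangulated

variable {C : Type*} [Category C] [Abelian C] [HasDerivedCategory C]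

open DerivedCategory

/-- Shifting identifies morphisms out of a complex concentrated in degree `n` with shifted
morphisms out of the complex concentrated in degree `0`. -/
noncomputable def singleShift {X : C} {Z : DerivedCategory C} (i k m : ℤ) (h : k + m = i)
    (f : (singleFunctor C i).obj X ⟶ Z) : (singleFunctor C m).obj X ⟶ Z⟦k⟧ :=
  ((singleFunctors C).shiftIso k m i h).inv.app X ≫ f⟦k⟧'

lemma singleShift_bijective {X : C} {Z : DerivedCategory C} (i k m : ℤ) (h : k + m = i) :
    Function.Bijective (singleShift (X := X) (Z := Z) i k m h) := by
  constructor
  · intro f g hfg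
    apply (shiftFunctor (DerivedCategory C) k).map_injective
    exact (cancel_epi _).1 hfg
  · intro g
    obtain ⟨f, hf⟩ := (shiftFunctor (DerivedCategory C) k).map_surjective
      (((singleFunctors C).shiftIso k m i h).hom.app X ≫ g)
    refine ⟨f, ?_⟩
    simp [singleShift, hf]

lemma singleShift_add {X : C} {Z : DerivedCategory C} (i k m : ℤ) (h : k + m = i)
    (f g : (singleFunctor C i).obj X ⟶ Z) :
    singleShift i k m h (f + g) = singleShift i k m h f + singleShift i k m h g := by
  simp [singleShift, Functor.map_add]

lemma singleShift_smul {R : Type*} [Ring R] [Linear R C] {X : C} {Z : DerivedCategory C}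
    (i k m : ℤ) (h : k + m = i) (r : R)
    (f : (singleFunctor C i).obj X ⟶ Z) :
    singleShift i k m h (r • f) = r • singleShift i k m h f := by
  simp [singleShift, Functor.map_smul]

lemma singleShift_comp {X Y : C} {Z : DerivedCategory C} (i k m : ℤ) (h : k + m = i)
    (g : Y ⟶ X) (f : (singleFunctor C i).obj X ⟶ Z) :
    singleShift i k m h ((singleFunctor C i).map g ≫ f) =
      (singleFunctor C m).map g ≫ singleShift i k m h f := by
  have := ((singleFunctors C).shiftIso k m i h).inv.naturality g
  simp only [Functor.comp_map] at this
  simp [singleShift, reassoc_of% this]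

lemma single_hom_eq_zero_of_ext [HasExt C] {X Y : C} (h : ∀ n : ℕ, Subsingleton (Abelian.Ext X Y n))
    (i j : ℤ) (f : (singleFunctor C i).obj X ⟶ (singleFunctor C j).obj Y) : f = 0 := by
  rcases lt_or_ge i j with hij | hij
  · exact TStructure.t.zero f i j hij
  · obtain ⟨n, rfl⟩ : ∃ n : ℕ, i = n + j := ⟨(i - j).toNat, by lia⟩
    apply (singleShift_bijective (n + j) (n + j) 0 (by lia)).1
    let e : ((singleFunctor C j).obj Y)⟦(n + j : ℤ)⟧ ≅ ((singleFunctor C 0).obj Y)⟦(n : ℤ)⟧ :=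
      (shiftFunctorAdd' (DerivedCategory C) j n (n + j) (by lia)).app _ ≪≫
        (shiftFunctor _ (n : ℤ)).mapIso (((singleFunctors C).shiftIso j 0 j (by lia)).app Y)
    have hs := h n
    have : Subsingleton ((singleFunctor C 0).obj X ⟶ ((singleFunctor C j).obj Y)⟦(n + j : ℤ)⟧) := by
      have h1 : Subsingleton ((singleFunctor C 0).obj X ⟶ ((singleFunctor C 0).obj Y)⟦(n : ℤ)⟧) :=
        (Abelian.Ext.homEquiv (X := X) (Y := Y) (n := n)).symm.subsingleton
      exact ((Iso.refl _).homCongr e).subsingleton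
    exact Subsingleton.elim _ _

end Derived

section ExtVanishing

open Abelian Limits

variable {A : Type} [CommRing A]

/-- Multiplication by `x` is bijective on `N` and zero on `W`. -/
lemma subsingleton_ext_of_smul_eq_zero {N W : ModuleCat.{0} A} {x : A}
    (hN : Function.Bijective (fun n : N ↦ x • n)) (hW : ∀ w : W, x • w = 0) (n : ℕ) :
    Subsingleton (Ext N W n) := by
  let f : N ⟶ N := x • 𝟙 N
  have : IsIso f := by
    rw [ConcreteCategory.isIso_iff_bijective]
    exact hN
  have key : ∀ e : Ext N W n, e = 0 := by
    intro e
    have h1 : (Ext.mk₀ f).comp e (zero_add n) = 0 := by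
      have : x • e = 0 := by
        have hz : x • (𝟙 W) = 0 := by
          ext w
          exact hW w
        rw [Ext.smul_eq_comp_mk₀, hz]; simp
      rw [← this]
      simp [f, Ext.mk₀_smul, Ext.smul_comp]
    calc e = (Ext.mk₀ (inv f)).comp ((Ext.mk₀ f).comp e (zero_add n)) (zero_add n) := by simp
      _ = 0 := by rw [h1]; simp
  exact ⟨fun e e' ↦ by rw [key e, key e']⟩

lemma subsingleton_ext_pi {N : ModuleCat.{0} A} {ι : Type} (W : ι → Type)
    [∀ i, AddCommGroup (W i)] [∀ i, Module A (W i)] (n : ℕ)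
    (h : ∀ i, Subsingleton (Ext N (ModuleCat.of A (W i)) n)) :
    Subsingleton (Ext N (ModuleCat.of A (∀ i, W i)) n) := by
  let pr (i : ι) : ModuleCat.of A (∀ i, W i) ⟶ ModuleCat.of A (W i) :=
    ModuleCat.ofHom (LinearMap.proj i)
  have hpr {T : ModuleCat.{0} A} (u v : T ⟶ ModuleCat.of A (∀ i, W i))
      (huv : ∀ i, u ≫ pr i = v ≫ pr i) : u = v := by
    refine ModuleCat.hom_ext (LinearMap.ext fun t ↦ funext fun i ↦ ?_)
    exact ConcreteCategory.congr_hom (huv i) t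
  have key : ∀ e : Ext N (ModuleCat.of A (∀ i, W i)) n, e = 0 := by
    intro e
    rcases n with - | n
    · obtain ⟨f, rfl⟩ := Ext.homEquiv₀.symm.surjective e
      have : f = 0 := by
        refine hpr _ _ fun i ↦ ?_
        apply Ext.homEquiv₀.symm.injective
        exact (h i).elim _ _
      simp [this]
    · let P := projectiveResolution N
      obtain ⟨f, hf, rfl⟩ := P.extMk_surjective e _ rfl
      have hf' (i : ι) : P.complex.d (n + 1 + 1) (n + 1) ≫ f ≫ pr i = 0 := by
        rw [reassoc_of% hf]; simp
      have hz (i : ι) := (P.extMk_eq_zero_iff (f ≫ pr i) _ rfl (hf' i) n rfl).1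
        ((h i).elim _ _)
      choose g hg using hz
      rw [P.extMk_eq_zero_iff _ _ _ _ n rfl]
      refine ⟨ModuleCat.ofHom (LinearMap.pi fun i ↦ (g i).hom), hpr _ _ fun i ↦ ?_⟩
      rw [← hg]
      rfl
  exact ⟨fun e e' ↦ by rw [key e, key e']⟩

lemma subsingleton_ext_of_isAdicComplete (I : Ideal A) [IsAdicComplete I A]
    {N : ModuleCat.{0} A} {x : A} (hx : x ∈ I)
    (hN : Function.Bijective (fun n : N ↦ x • n)) (n : ℕ) :
    Subsingleton (Ext N (ModuleCat.of A A) n) := by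
  have hpow (k : ℕ) : Function.Bijective (fun n : N ↦ x ^ k • n) := by
    induction k with
    | zero =>
      simp only [pow_zero, one_smul]
      exact Function.bijective_id
    | succ k ih =>
      convert hN.comp ih using 1
      funext n
      simp [pow_succ', mul_smul]
  let W (k : ℕ) : Type := A ⧸ I ^ k
  have hW (k n : ℕ) : Subsingleton (Ext N (ModuleCat.of A (W k)) n) := by
    refine subsingleton_ext_of_smul_eq_zero (hpow k) (fun w ↦ ?_) n
    obtain ⟨w, rfl⟩ := Ideal.Quotient.mk_surjective w
    change Ideal.Quotient.mk _ (x ^ k * w) = 0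
    rw [Ideal.Quotient.eq_zero_iff_mem]
    exact Ideal.mul_mem_right _ _ (Ideal.pow_mem_pow hx k)
  have hP (n : ℕ) := subsingleton_ext_pi (N := N) W n (fun k ↦ hW k n)
  let i : A →ₗ[A] (∀ k, W k) := LinearMap.pi fun k ↦ Submodule.mkQ (I ^ k)
  let t (k : ℕ) : W (k + 1) →ₗ[A] W k := Submodule.factor (Ideal.pow_le_pow_right (by lia))
  let d : (∀ k, W k) →ₗ[A] (∀ k, W k) :=
    LinearMap.pi fun k ↦ LinearMap.proj k - t k ∘ₗ LinearMap.proj (k + 1)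
  have hid : d ∘ₗ i = 0 := by
    ext k
    exact sub_self (Submodule.mkQ (I ^ k) 1)
  let S : ShortComplex (ModuleCat.{0} A) := ShortComplex.mk (ModuleCat.ofHom i) (ModuleCat.ofHom d)
    (by rw [← ModuleCat.ofHom_comp, hid]; rfl)
  have hmem (k : ℕ) (u v : A) : u ≡ v [SMOD (I ^ k • ⊤ : Submodule A A)] ↔
      (Submodule.mkQ (I ^ k) u : W k) = Submodule.mkQ (I ^ k) v := by
    rw [SModEq.sub_mem, ← sub_eq_zero, ← map_sub, ← LinearMap.mem_ker, Submodule.ker_mkQ]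
    simp
  have hS : S.ShortExact := by
    refine ModuleCat.shortComplex_shortExact _ ?_ ?_ ?_
    · intro b
      refine ⟨fun hb ↦ ?_, fun ⟨u, hu⟩ ↦ by rw [← hu]; exact LinearMap.congr_fun hid u⟩
      change d b = 0 at hb
      have hb' (k : ℕ) : b k = t k (b (k + 1)) := by
        simpa [d, sub_eq_zero] using congrFun hb k
      choose f hf using fun k ↦ Submodule.mkQ_surjective (I ^ k) (b k)
      have hstep (k l : ℕ) : Submodule.mkQ (I ^ k) (f (k + l)) = b k := by
        induction l with
        | zero => exact hf k
        | succ l ih =>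
          rw [← ih, ← sub_eq_zero, ← map_sub, ← LinearMap.mem_ker, Submodule.ker_mkQ]
          refine Ideal.pow_le_pow_right (show k ≤ k + l by lia) ?_
          rw [← Submodule.ker_mkQ (I ^ (k + l)), LinearMap.mem_ker, map_sub, sub_eq_zero,
            hf (k + l), hb' (k + l), ← hf (k + l + 1)]
          rfl
      obtain ⟨L, hL⟩ := IsPrecomplete.prec' (I := I) f (fun {m n} hmn ↦ by
        obtain ⟨l, rfl⟩ := Nat.exists_eq_add_of_le hmn
        rw [hmem, hstep, hf])
      refine ⟨L, ?_⟩
      funext k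
      have := hL k
      rw [hmem, hf] at this
      exact this.symm
    · change Function.Injective i
      rw [injective_iff_map_eq_zero]
      intro u hu
      refine IsHausdorff.haus' (I := I) u fun k ↦ ?_
      rw [hmem]
      rw [map_zero]
      exact congrFun hu k
    · intro b
      choose f hf using fun k ↦ Submodule.mkQ_surjective (I ^ k) (b k)
      refine ⟨fun k ↦ Submodule.mkQ (I ^ k) (- ∑ l ∈ Finset.range k, f l), ?_⟩
      funext k
      rw [← hf k]
      change Submodule.mkQ (I ^ k) _ - Submodule.mkQ (I ^ k) _ = _
      rw [← map_sub, Finset.sum_range_succ]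
      congr 1
      simp
  have key : ∀ e : Ext N S.X₁ n, e = 0 := by
    intro e
    rcases n with - | n
    · refine Ext.postcomp_mk₀_injective_of_mono _ S.f (hf := hS.mono_f) ?_
      exact (hP 0).elim _ _
    · obtain ⟨e', rfl⟩ := Ext.covariant_sequence_exact₁ N hS e ((hP _).elim _ _) rfl
      rw [(hP n).elim e' 0, Ext.zero_comp]
  exact ⟨fun e e' ↦ (key e).trans (key e').symm⟩

end ExtVanishing

section Torsion

open Abelian Limits

variable {A : Type} [CommRing A]

/-- Every element is annihilated by a power of the ideal. -/
def IsPowTorsion (a : Ideal A) (H : Type) [AddCommGroup H] [Module A H] : Prop :=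
  ∀ h : H, ∃ k : ℕ, ∀ r ∈ a ^ k, r • h = 0

/-- The quotient `A / a ^ t`. -/
abbrev quo (a : Ideal A) (t : ℕ) : ModuleCat.{0} A := ModuleCat.of A (A ⧸ a ^ t)

/-- The projection `A / a ^ s → A / a ^ t` for `t ≤ s`. -/
def quoMap (a : Ideal A) {t s : ℕ} (h : t ≤ s) : quo a s ⟶ quo a t :=
  ModuleCat.ofHom (Submodule.mapQ _ _ LinearMap.id (Ideal.pow_le_pow_right h))

lemma quoMap_comp (a : Ideal A) {t s r : ℕ} (h : t ≤ s) (h' : s ≤ r) :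
    quoMap a h' ≫ quoMap a h = quoMap a (h.trans h') := by
  refine ModuleCat.hom_ext (Submodule.linearMap_qext _ ?_)
  rfl

@[simp]
lemma quoMap_one (a : Ideal A) {t s : ℕ} (h : t ≤ s) :
    quoMap a h (1 : A ⧸ a ^ s) = (1 : A ⧸ a ^ t) := rfl

lemma quo_hom_ext {a : Ideal A} {t : ℕ} {M : ModuleCat.{0} A} {f g : quo a t ⟶ M}
    (h : f (1 : A ⧸ a ^ t) = g (1 : A ⧸ a ^ t)) : f = g := by
  refine ModuleCat.hom_ext (Submodule.linearMap_qext _ (LinearMap.ext_ring h))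

/-- The map from `A / a ^ t` determined by an element annihilated by `a ^ t`. -/
def quoDesc (a : Ideal A) {t : ℕ} {M : ModuleCat.{0} A} (m : M) (hm : ∀ r ∈ a ^ t, r • m = 0) :
    quo a t ⟶ M :=
  ModuleCat.ofHom (Submodule.liftQ (a ^ t) (LinearMap.toSpanSingleton A M m)
    (fun r hr ↦ by rw [LinearMap.mem_ker]; exact hm r hr))

@[simp]
lemma quoDesc_one (a : Ideal A) {t : ℕ} {M : ModuleCat.{0} A} (m : M)
    (hm : ∀ r ∈ a ^ t, r • m = 0) : quoDesc a m hm (1 : A ⧸ a ^ t) = m := by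
  change Submodule.liftQ (a ^ t) (LinearMap.toSpanSingleton A M m) _
    (Submodule.Quotient.mk 1) = m
  rw [Submodule.liftQ_apply]
  simp

lemma quo_isPowTorsion (a : Ideal A) (t : ℕ) : IsPowTorsion a (quo a t) := by
  intro h
  refine ⟨t, fun r hr ↦ ?_⟩
  obtain ⟨h, rfl⟩ := Ideal.Quotient.mk_surjective h
  change Ideal.Quotient.mk _ (r * h) = 0
  rw [Ideal.Quotient.eq_zero_iff_mem]
  exact Ideal.mul_mem_right _ _ hr

/-- The submodule of elements annihilated by a power of `a`. -/
def powTorsion (a : Ideal A) (M : Type) [AddCommGroup M] [Module A M] : Submodule A M where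
  carrier := {m | ∃ k : ℕ, ∀ r ∈ a ^ k, r • m = 0}
  zero_mem' := ⟨0, by simp⟩
  add_mem' := by
    rintro u v ⟨k, hk⟩ ⟨l, hl⟩
    refine ⟨k + l, fun r hr ↦ ?_⟩
    rw [smul_add, hk _ (Ideal.pow_le_pow_right (by lia) hr),
      hl _ (Ideal.pow_le_pow_right (by lia) hr), add_zero]
  smul_mem' := by
    rintro c u ⟨k, hk⟩
    exact ⟨k, fun r hr ↦ by rw [smul_comm, hk r hr, smul_zero]⟩

lemma isPowTorsion_powTorsion (a : Ideal A) (M : Type) [AddCommGroup M] [Module A M] :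
    IsPowTorsion a (powTorsion a M) := by
  rintro ⟨h, k, hk⟩
  exact ⟨k, fun r hr ↦ Subtype.ext (hk r hr)⟩

lemma IsPowTorsion.of_surjective {a : Ideal A} {M N : Type} [AddCommGroup M] [Module A M]
    [AddCommGroup N] [Module A N] (hM : IsPowTorsion a M) (f : M →ₗ[A] N)
    (hf : Function.Surjective f) : IsPowTorsion a N := by
  intro n
  obtain ⟨m, rfl⟩ := hf n
  obtain ⟨k, hk⟩ := hM m
  exact ⟨k, fun r hr ↦ by rw [← map_smul, hk r hr, map_zero]⟩

lemma exists_pow_smul_eq_zero_of_fg {a : Ideal A} {M N : Type} [AddCommGroup M] [Module A M]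
    [AddCommGroup N] [Module A N] [Module.Finite A N] (hM : IsPowTorsion a M) (f : N →ₗ[A] M) :
    ∃ k : ℕ, ∀ r ∈ a ^ k, ∀ n, r • f n = 0 := by
  obtain ⟨s, hs⟩ := Module.Finite.fg_top (R := A) (M := N)
  choose k hk using fun n ↦ hM (f n)
  refine ⟨s.sup k, fun r hr n ↦ ?_⟩
  have : n ∈ Submodule.span A (s : Set N) := hs ▸ Submodule.mem_top
  induction this using Submodule.span_induction with
  | mem x hx => exact hk x r (Ideal.pow_le_pow_right (Finset.le_sup hx) hr)
  | zero => simp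
  | add x y _ _ hx hy => simp [hx, hy]
  | smul c x _ hx => rw [map_smul, smul_comm, hx, smul_zero]

/-- Over a Noetherian ring, the torsion submodule of an injective module is injective. -/
lemma injective_powTorsion [IsNoetherianRing A] (a : Ideal A) (J : Type) [AddCommGroup J]
    [Module A J] [Module.Injective A J] : Module.Injective A (powTorsion a J) := by
  refine Module.Baer.injective fun I f ↦ ?_
  obtain ⟨k, hk⟩ := exists_pow_smul_eq_zero_of_fg (isPowTorsion_powTorsion a J) f
  obtain ⟨l, hl⟩ := Ideal.exists_pow_inf_eq_pow_smul a (I : Submodule A A)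
  have hAR := hl (k + l) (by lia)
  rw [Nat.add_sub_cancel] at hAR
  let q : I →ₗ[A] A ⧸ a ^ (k + l) := Submodule.mkQ _ ∘ₗ I.subtype
  have hker : LinearMap.ker q ≤ LinearMap.ker f := by
    rintro ⟨u, hu⟩ hq
    have hu' : u ∈ a ^ (k + l) := by
      simpa [q, Ideal.Quotient.eq_zero_iff_mem] using hq
    have : u ∈ a ^ k • (a ^ l • ⊤ ⊓ I : Submodule A A) := by
      rw [← hAR]
      exact ⟨by simpa using hu', hu⟩
    have : u ∈ a ^ k • I := Submodule.smul_mono le_rfl inf_le_right this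
    have key : ∀ v (hv : v ∈ a ^ k • I), ∃ hv' : v ∈ I, f ⟨v, hv'⟩ = 0 := by
      intro v hv
      induction hv using Submodule.smul_induction_on' with
      | smul r hr n hn => exact ⟨I.smul_mem r hn, (map_smul f r ⟨n, hn⟩).trans (hk r hr _)⟩
      | add x _ y _ hx hy =>
        obtain ⟨hx', hx⟩ := hx
        obtain ⟨hy', hy⟩ := hy
        exact ⟨I.add_mem hx' hy', (map_add f ⟨x, hx'⟩ ⟨y, hy'⟩).trans (by rw [hx, hy, add_zero])⟩
    exact (key u this).2
  obtain ⟨g, hg⟩ := Module.Injective.out ((LinearMap.ker q).liftQ q le_rfl)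
    (by rw [← LinearMap.ker_eq_bot]; exact Submodule.ker_liftQ_eq_bot _ _ _ le_rfl)
    ((powTorsion a J).subtype ∘ₗ (LinearMap.ker q).liftQ f hker)
  refine ⟨LinearMap.codRestrict _ (g ∘ₗ Submodule.mkQ (a ^ (k + l))) fun u ↦
    ⟨k + l, fun r hr ↦ ?_⟩, fun u hu ↦ Subtype.ext ?_⟩
  · rw [← map_smul, LinearMap.comp_apply]
    convert map_zero g
    simp only [Submodule.mkQ_apply, Submodule.Quotient.mk_eq_zero]
    exact Ideal.mul_mem_right _ _ hr
  · exact hg (Submodule.Quotient.mk ⟨u, hu⟩)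

lemma exists_mono_injective_isPowTorsion [IsNoetherianRing A] (a : Ideal A) (H : ModuleCat.{0} A)
    (hH : IsPowTorsion a H) :
    ∃ (G : ModuleCat.{0} A) (f : H ⟶ G), Mono f ∧ Injective G ∧ IsPowTorsion a G := by
  let J := Injective.under H
  have hJ : Injective (ModuleCat.of A J) := inferInstanceAs (Injective (Injective.under H))
  have : Module.Injective A J := (Module.injective_iff_injective_object A J).2 hJ
  have := injective_powTorsion a J
  let f : H ⟶ ModuleCat.of A (powTorsion a J) :=
    ModuleCat.ofHom (LinearMap.codRestrict _ (Injective.ι H).hom fun h ↦ by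
      obtain ⟨k, hk⟩ := hH h
      exact ⟨k, fun r hr ↦ by rw [← map_smul, hk r hr, map_zero]⟩)
  refine ⟨_, f, ?_, (Module.injective_iff_injective_object A _).1 this,
    isPowTorsion_powTorsion a J⟩
  rw [ModuleCat.mono_iff_injective]
  intro u v huv
  exact (ModuleCat.mono_iff_injective _).1 (inferInstanceAs (Mono (Injective.ι H)))
    (congrArg Subtype.val huv)

lemma shortExact_cokernel {C : Type*} [Category C] [Abelian C] {X Y : C} (f : X ⟶ Y) [Mono f] :
    (ShortComplex.mk f (cokernel.π f) (by simp)).ShortExact where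
  exact := ShortComplex.exact_cokernel f

/-- Positive degree extension classes of `A / a ^ t` by a torsion module die on some
`A / a ^ s`. -/
lemma exists_quoMap_comp_eq_zero [IsNoetherianRing A] (a : Ideal A) (n : ℕ) :
    ∀ (H : ModuleCat.{0} A) (_ : IsPowTorsion a H) (t : ℕ) (e : Ext (quo a t) H (n + 1)),
    ∃ (s : ℕ) (h : t ≤ s), (Ext.mk₀ (quoMap a h)).comp e (zero_add _) = 0 := by
  induction n with
  | zero =>
    intro H hH t e
    obtain ⟨G, f, hf, hG, hGt⟩ := exists_mono_injective_isPowTorsion a H hH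
    obtain ⟨e', rfl⟩ := Ext.covariant_sequence_exact₁ _ (shortExact_cokernel f) e
      (Ext.eq_zero_of_injective _) rfl
    obtain ⟨(g : quo a t ⟶ cokernel f), rfl⟩ := Ext.homEquiv₀.symm.surjective e'
    have hπ : Function.Surjective (cokernel.π f) :=
      (ModuleCat.epi_iff_surjective _).1 inferInstance
    obtain ⟨m, hm⟩ := hπ (g (1 : A ⧸ a ^ t))
    obtain ⟨k, hk⟩ := hGt m
    let s := max t k
    refine ⟨s, le_max_left _ _, ?_⟩
    have hq : quoMap a (le_max_left t k) ≫ g =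
        quoDesc a m (fun r hr ↦ hk r (Ideal.pow_le_pow_right (le_max_right t k) hr)) ≫
          cokernel.π f := by
      apply quo_hom_ext
      change g (quoMap a _ (1 : A ⧸ a ^ s)) = cokernel.π f (quoDesc a m _ (1 : A ⧸ a ^ s))
      rw [quoMap_one, quoDesc_one, hm]
    have := (shortExact_cokernel f).comp_extClass
    dsimp only at this
    rw [← Ext.comp_assoc_of_second_deg_zero, Ext.homEquiv₀_symm_apply, Ext.mk₀_comp_mk₀, hq,
      ← Ext.mk₀_comp_mk₀, Ext.comp_assoc_of_second_deg_zero, this, Ext.comp_zero]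
  | succ n ih =>
    intro H hH t e
    obtain ⟨G, f, hf, hG, hGt⟩ := exists_mono_injective_isPowTorsion a H hH
    obtain ⟨e', rfl⟩ := Ext.covariant_sequence_exact₁ _ (shortExact_cokernel f) e
      (Ext.eq_zero_of_injective _) rfl
    have hC : IsPowTorsion a ↑(cokernel f) :=
      hGt.of_surjective (cokernel.π f).hom ((ModuleCat.epi_iff_surjective _).1 inferInstance)
    obtain ⟨s, hs, h⟩ := ih _ hC t e'
    refine ⟨s, hs, ?_⟩
    rw [← Ext.comp_assoc (Ext.mk₀ _) e' _ (zero_add _) rfl (by lia), h, Ext.zero_comp]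

end Torsion

section Localization

open Abelian Limits

variable {A : Type} [CommRing A] (x : A)

/-- Restriction of scalars from the localization away from `x`. -/
noncomputable abbrev resAway : ModuleCat.{0} (Localization.Away x) ⥤ ModuleCat.{0} A :=
  ModuleCat.restrictScalars (algebraMap A (Localization.Away x))

/-- Extension of scalars to the localization away from `x`. -/
noncomputable abbrev extAway : ModuleCat.{0} A ⥤ ModuleCat.{0} (Localization.Away x) :=
  ModuleCat.extendScalars (algebraMap A (Localization.Away x))

instance : PreservesFiniteLimits (extAway x) :=
  ModuleCat.preservesFiniteLimits_extendScalars_of_flat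
    (by rw [RingHom.flat_algebraMap_iff]; exact IsLocalization.flat _ (Submonoid.powers x))

lemma bijective_smul_resAway (N : ModuleCat.{0} (Localization.Away x)) :
    Function.Bijective (fun n : (resAway x).obj N ↦ x • n) := by
  have hu : IsUnit (algebraMap A (Localization.Away x) x) :=
    IsLocalization.Away.algebraMap_isUnit x
  exact (hu.smul_bijective (β := N))

lemma injective_resAway (J : ModuleCat.{0} (Localization.Away x)) [Injective J] :
    Injective ((resAway x).obj J) :=
  Injective.injective_of_adjoint
    (ModuleCat.extendRestrictScalarsAdj (algebraMap A (Localization.Away x))) J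

lemma subsingleton_ext_resAway {H : ModuleCat.{0} A} (hH : ∀ h : H, ∃ k : ℕ, x ^ k • h = 0)
    (n : ℕ) : ∀ (N : ModuleCat.{0} (Localization.Away x)),
    Subsingleton (Ext H ((resAway x).obj N) n) := by
  induction n with
  | zero =>
    intro N
    have : Subsingleton (H ⟶ (resAway x).obj N) := by
      refine subsingleton_of_forall_eq 0 fun f ↦ ?_
      refine ModuleCat.hom_ext (LinearMap.ext fun h ↦ ?_)
      obtain ⟨k, hk⟩ := hH h
      have hz : x ^ k • f h = 0 := by rw [← map_smul, hk, map_zero]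
      change f h = 0
      clear hk
      induction k with
      | zero => simpa using hz
      | succ k ih =>
        apply ih
        apply (bijective_smul_resAway x N).1
        simpa only [smul_smul, ← pow_succ', smul_zero] using hz
    exact Ext.homEquiv₀.subsingleton
  | succ n ih =>
    intro N
    refine subsingleton_of_forall_eq 0 fun e ↦ ?_
    have hS := (shortExact_cokernel (Injective.ι N)).map_of_exact (resAway x)
    have : Injective (((ShortComplex.mk (Injective.ι N) (cokernel.π (Injective.ι N))
      (by simp)).map (resAway x)).X₂) := injective_resAway x (Injective.under N)
    obtain ⟨e', rfl⟩ := Ext.covariant_sequence_exact₁ _ hS e (Ext.eq_zero_of_injective _) rfl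
    have h0 : e' = 0 := (ih (cokernel (Injective.ι N))).elim _ _
    rw [h0]
    exact Ext.zero_comp ..

end Localization

section Truncation

open Limits Triangulated Pretriangulated

variable {C : Type*} [Category C] [Abelian C] [HasDerivedCategory C]

open DerivedCategory

lemma exists_truncation (X : DerivedCategory C) (p : ℤ) [X.IsGE p] :
    ∃ (Y : C) (B : DerivedCategory C) (f : (singleFunctor C p).obj Y ⟶ X) (g : X ⟶ B)
      (h : B ⟶ ((singleFunctor C p).obj Y)⟦(1 : ℤ)⟧),
      Triangle.mk f g h ∈ distTriang _ ∧ B.IsGE (p + 1) ∧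
      Nonempty (Y ≅ (homologyFunctor C p).obj X) ∧
      (∀ j : ℤ, p < j → IsIso ((homologyFunctor C j).map g)) ∧
      (∀ (M : C) (u : M ⟶ Y), (singleFunctor C p).map u ≫ f = 0 → u = 0) := by
  obtain ⟨P, B, hP, hB, f, g, h, hT⟩ := TStructure.t.exists_triangle X p (p + 1) rfl
  have hP' : P.IsLE p := ⟨hP⟩
  have hB' : B.IsGE (p + 1) := ⟨hB⟩
  have hPge : P.IsGE p := by
    rw [isGE_iff]
    intro i hi
    exact ShortComplex.Exact.isZero_of_both_zeros
      (HomologySequence.exact₁ _ hT (i - 1) i)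
      ((isZero_of_isGE B (p + 1) (i - 1) (by lia)).eq_of_src _ _)
      ((isZero_of_isGE X p i hi).eq_of_tgt _ _)
  obtain ⟨Y, ⟨e⟩⟩ := exists_iso_singleFunctor_obj_of_isGE_of_isLE P p
  have hT' : Triangle.mk (e.inv ≫ f) g (h ≫ e.hom⟦(1 : ℤ)⟧') ∈ distTriang _ := by
    refine isomorphic_distinguished _ hT _ ?_
    refine Triangle.isoMk _ _ e.symm (Iso.refl X) (Iso.refl B) ?_ ?_ ?_
    · exact Category.comp_id (e.inv ≫ f)
    · exact (Category.comp_id g).trans (Category.id_comp g).symm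
    · change (h ≫ e.hom⟦(1 : ℤ)⟧') ≫ e.inv⟦(1 : ℤ)⟧' = 𝟙 B ≫ h
      rw [Category.assoc, ← Functor.map_comp, e.hom_inv_id, CategoryTheory.Functor.map_id,
        Category.comp_id,
        Category.id_comp]
  have hf : IsIso ((homologyFunctor C p).map (e.inv ≫ f)) := by
    have h1 : Mono ((homologyFunctor C p).map (e.inv ≫ f)) :=
      (HomologySequence.mono_homologyMap_mor₁_iff _ hT' (p - 1) p).2
        ((isZero_of_isGE B (p + 1) (p - 1) (by lia)).eq_of_src _ _)
    have h2 : Epi ((homologyFunctor C p).map (e.inv ≫ f)) :=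
      (HomologySequence.epi_homologyMap_mor₁_iff _ hT' p).2
        ((isZero_of_isGE B (p + 1) p (by lia)).eq_of_tgt _ _)
    exact isIso_of_mono_of_epi _
  let s := singleFunctorCompHomologyFunctorIso C p
  refine ⟨Y, B, e.inv ≫ f, g, h ≫ e.hom⟦(1 : ℤ)⟧', hT', hB',
    ⟨(s.app Y).symm ≪≫ asIso ((homologyFunctor C p).map (e.inv ≫ f))⟩,
    fun j hj => ?_, fun M u hu => ?_⟩
  · have h1 : Mono ((homologyFunctor C j).map g) :=
      (HomologySequence.mono_homologyMap_mor₂_iff _ hT j).2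
        ((isZero_of_isLE P p j hj).eq_of_src _ _)
    have h2 : Epi ((homologyFunctor C j).map g) :=
      (HomologySequence.epi_homologyMap_mor₂_iff _ hT j (j + 1)).2
        ((isZero_of_isLE P p (j + 1) (by lia)).eq_of_tgt _ _)
    exact isIso_of_mono_of_epi _
  · apply (singleFunctor C p).map_injective
    have h3 := congrArg (homologyFunctor C p).map hu
    rw [Functor.map_comp, Functor.map_zero] at h3
    have h4 : (homologyFunctor C p).map ((singleFunctor C p).map u) = 0 :=
      (cancel_mono ((homologyFunctor C p).map (e.inv ≫ f))).1 (by rw [h3, zero_comp])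
    have h5 := NatIso.naturality_1 s u
    change s.inv.app M ≫ (homologyFunctor C p).map ((singleFunctor C p).map u) ≫ s.hom.app Y = u
      at h5
    rw [h4] at h5
    rw [← h5]
    simp

lemma isZero_of_isGE_of_isLE (X : DerivedCategory C) (p q : ℤ) (h : q < p) [X.IsGE p] [X.IsLE q] :
    IsZero X := by
  rw [IsZero.iff_id_eq_zero]
  exact TStructure.t.zero (𝟙 X) q p h

lemma devissage (P : DerivedCategory C → Prop) (hz : ∀ X, IsZero X → P X)
    (hext : ∀ T ∈ distTriang (DerivedCategory C), P T.obj₁ → P T.obj₃ → P T.obj₂) (n : ℕ) :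
    ∀ (p : ℤ) (X : DerivedCategory C) (_ : X.IsGE p) (_ : X.IsLE (p + n - 1))
      (_ : ∀ j Y, Nonempty (Y ≅ (homologyFunctor C j).obj X) → P ((singleFunctor C j).obj Y)),
      P X := by
  induction n with
  | zero =>
    intro p X _ _ _
    exact hz _ (isZero_of_isGE_of_isLE X p (p + (0 : ℕ) - 1) (by simp))
  | succ n ih =>
    intro p X _ _ hX
    obtain ⟨Y, B, f, g, h, hT, hB, hY, hg, -⟩ := exists_truncation X p
    have hB' : ∀ j Y, Nonempty (Y ≅ (homologyFunctor C j).obj B) →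
        P ((singleFunctor C j).obj Y) := by
      rintro j Y ⟨e⟩
      by_cases hj : p < j
      · have := hg j hj
        exact hX j Y ⟨e ≪≫ (asIso ((homologyFunctor C j).map g)).symm⟩
      · exact hz _ (Functor.map_isZero _ ((isZero_of_isGE B (p + 1) j (by lia)).of_iso e))
    refine hext _ hT (hX p Y hY) (ih (p + 1) B hB ?_ hB')
    rw [isLE_iff]
    intro i hi
    by_cases hj : p < i
    · have := hg i hj
      exact (isZero_of_isLE X (p + (n + 1 : ℕ) - 1) i (by push_cast at hi ⊢; lia)).of_iso
        (asIso ((homologyFunctor C i).map g)).symm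
    · exact isZero_of_isGE B (p + 1) i (by lia)

end Truncation

section NatTrans

open Limits Triangulated Pretriangulated

variable {C : Type*} [Category C]

lemma natTrans_app_eq_of_iso {G : C ⥤ C} (τ : 𝟭 C ⟶ G) {X Y : C} (v : X ≅ Y) :
    τ.app X = v.hom ≫ τ.app Y ≫ G.map v.inv := by
  have h := τ.naturality v.inv
  simp only [Functor.id_map] at h
  rw [← h]
  exact (Iso.hom_inv_id_assoc v _).symm

variable [Abelian C]

lemma exists_homologicalComplex_hom_of_natTrans (G : C ⥤ C) [G.Additive] [G.PreservesHomology]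
    (τ : 𝟭 C ⟶ G) {ι : Type*} {c : ComplexShape ι} (K : HomologicalComplex C c) :
    ∃ (L : HomologicalComplex C c) (η : K ⟶ L), ∀ j,
      ∃ e : L.homology j ≅ G.obj (K.homology j),
        HomologicalComplex.homologyMap η j ≫ e.hom = τ.app (K.homology j) := by
  let η : K ⟶ (G.mapHomologicalComplex c).obj K :=
    { f := fun i => τ.app (K.X i)
      comm' := fun i j _ => (τ.naturality (K.d i j)).symm }
  refine ⟨(G.mapHomologicalComplex c).obj K, η, fun j => ?_⟩
  let S := K.sc j
  let e₀ : S.homology ≅ S.homology := S.mapHomologyIso (𝟭 C)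
  let e₁ : ((G.mapHomologicalComplex c).obj K).homology j ≅ G.obj S.homology := S.mapHomologyIso G
  have h : τ.app S.homology = e₀.inv ≫ HomologicalComplex.homologyMap η j ≫ e₁.hom :=
    NatTrans.app_homology τ S
  refine ⟨e₁ ≪≫ G.mapIso e₀.symm, ?_⟩
  have h' : HomologicalComplex.homologyMap η j ≫ e₁.hom = e₀.hom ≫ τ.app S.homology :=
    ((Iso.eq_inv_comp _).1 h).symm
  change HomologicalComplex.homologyMap η j ≫ e₁.hom ≫ G.map e₀.inv = τ.app S.homology
  rw [reassoc_of% h']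
  exact (Category.assoc _ _ _).trans (natTrans_app_eq_of_iso τ e₀).symm

open DerivedCategory

lemma exists_hom_of_natTrans [HasDerivedCategory C] (G : C ⥤ C) [G.Additive] [G.PreservesHomology]
    (τ : 𝟭 C ⟶ G) (F : DerivedCategory C) :
    ∃ (F' : DerivedCategory C) (β : F ⟶ F'), ∀ j,
      ∃ e : (homologyFunctor C j).obj F' ≅ G.obj ((homologyFunctor C j).obj F),
        (homologyFunctor C j).map β ≫ e.hom = τ.app ((homologyFunctor C j).obj F) := by
  obtain ⟨L, η, h⟩ := exists_homologicalComplex_hom_of_natTrans G τ (Q.objPreimage F)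
  let u := Q.objObjPreimageIso F
  refine ⟨Q.obj L, u.inv ≫ Q.map η, fun j => ?_⟩
  obtain ⟨e, he⟩ := h j
  let w : (homologyFunctor C j).obj (Q.obj (Q.objPreimage F)) ≅ (Q.objPreimage F).homology j :=
    (homologyFunctorFactors C j).app (Q.objPreimage F)
  let w' : (homologyFunctor C j).obj (Q.obj L) ≅ L.homology j := (homologyFunctorFactors C j).app L
  let v : (homologyFunctor C j).obj F ≅ (Q.objPreimage F).homology j :=
    (homologyFunctor C j).mapIso u.symm ≪≫ w
  have h1 : (homologyFunctor C j).map (Q.map η) ≫ w'.hom =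
    w.hom ≫ HomologicalComplex.homologyMap η j := homologyFunctorFactors_hom_naturality η j
  refine ⟨w' ≪≫ e ≪≫ G.mapIso v.symm, ?_⟩
  rw [natTrans_app_eq_of_iso τ v, ← he]
  simp [v, reassoc_of% h1]

end NatTrans

section Away

open Limits Triangulated Pretriangulated

open scoped ChangeOfRings

variable {A : Type} [CommRing A] (x : A)

/-- The localization away from `x`, as an endofunctor of `A`-modules. -/
noncomputable abbrev locAway : ModuleCat.{0} A ⥤ ModuleCat.{0} A := extAway x ⋙ resAway x

/-- The canonical map to the localization away from `x`. -/
noncomputable abbrev toLocAway : 𝟭 (ModuleCat.{0} A) ⟶ locAway x :=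
  (ModuleCat.extendRestrictScalarsAdj (algebraMap A (Localization.Away x))).unit

lemma exists_pow_smul_eq_zero_of_toLocAway_eq_zero {M : ModuleCat.{0} A} {m : M}
    (hm : (toLocAway x).app M m = 0) : ∃ k : ℕ, x ^ k • m = 0 := by
  let N : ModuleCat.{0} (Localization.Away x) :=
    ModuleCat.of (Localization.Away x) (LocalizedModule (Submonoid.powers x) M)
  let g : M ⟶ (resAway x).obj N := ModuleCat.ofHom
    (X := M) (Y := (resAway x).obj N)
    { toFun := fun m => LocalizedModule.mk m 1
      map_add' := fun m n => (LocalizedModule.mkLinearMap (Submonoid.powers x) M).map_add m n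
      map_smul' := fun r m => by
        change _ = (algebraMap A (Localization.Away x) r) • (LocalizedModule.mk m 1 : N)
        rw [algebraMap_smul]
        exact (LocalizedModule.mkLinearMap (Submonoid.powers x) M).map_smul r m }
  let adj := ModuleCat.extendRestrictScalarsAdj (algebraMap A (Localization.Away x))
  have hg : adj.unit.app M ≫ (resAway x).map ((adj.homEquiv _ _).symm g) = g :=
    (adj.homEquiv_unit _ _ _).symm.trans (Equiv.apply_symm_apply _ _)
  have h0 : g m = 0 := by
    rw [← hg, ModuleCat.comp_apply, hm, map_zero]
  obtain ⟨⟨_, k, rfl⟩, hk⟩ := (IsLocalizedModule.eq_zero_iff (Submonoid.powers x)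
    (LocalizedModule.mkLinearMap (Submonoid.powers x) M)).1 h0
  exact ⟨k, hk⟩

lemma exists_pow_smul_eq_toLocAway (M : ModuleCat.{0} A) (z : (locAway x).obj M) :
    ∃ (k : ℕ) (m : M), x ^ k • z = (toLocAway x).app M m := by
  have hadd (z w : (locAway x).obj M) (hz : ∃ (k : ℕ) (m : M), x ^ k • z = (toLocAway x).app M m)
      (hw : ∃ (k : ℕ) (m : M), x ^ k • w = (toLocAway x).app M m) :
      ∃ (k : ℕ) (m : M), x ^ k • (z + w) = (toLocAway x).app M m := by
    obtain ⟨k, m, hz⟩ := hz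
    obtain ⟨l, n, hw⟩ := hw
    refine ⟨k + l, x ^ l • m + x ^ k • n, ?_⟩
    have h1 := map_add ((toLocAway x).app M).hom (x ^ l • m) (x ^ k • n)
    have h2 := map_smul ((toLocAway x).app M).hom (x ^ l) m
    have h3 := map_smul ((toLocAway x).app M).hom (x ^ k) n
    refine Eq.trans ?_ (h1.trans (congrArg₂ _ h2 h3)).symm
    change _ = x ^ l • ((toLocAway x).app M m) + x ^ k • ((toLocAway x).app M n)
    rw [← hz, ← hw, smul_smul, smul_smul, ← pow_add, ← pow_add, add_comm l k, ← smul_add]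
  refine TensorProduct.induction_on (motive := fun z : (locAway x).obj M =>
    ∃ (k : ℕ) (m : M), x ^ k • z = (toLocAway x).app M m) z ⟨0, 0, ?_⟩
    (fun (s : Localization.Away x) m => ?_) hadd
  · exact (smul_zero (A := (locAway x).obj M) _).trans (map_zero ((toLocAway x).app M).hom).symm
  · obtain ⟨⟨r, ⟨_, k, rfl⟩⟩, hs⟩ :=
      IsLocalization.surj (S := Localization.Away x) (Submonoid.powers x) s
    refine ⟨k, r • m, ?_⟩
    have h1 : (toLocAway x).app M (r • m) = r • (toLocAway x).app M m :=
      map_smul ((toLocAway x).app M).hom r m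
    rw [h1]
    have h2 : algebraMap A (Localization.Away x) (x ^ k) * s =
        algebraMap A (Localization.Away x) r * 1 := by
      rw [mul_one, mul_comm]
      exact hs
    exact congrArg (fun t => (t ⊗ₜ[A,algebraMap A (Localization.Away x)] m : (extAway x).obj M)) h2

lemma pow_torsion_of_exact (y : A) {S : ShortComplex (ModuleCat.{0} A)} (hS : S.Exact)
    (h₁ : ∀ z : S.X₁, ∃ k : ℕ, y ^ k • z = 0) (h₃ : ∀ z : S.X₃, ∃ k : ℕ, y ^ k • z = 0) (z : S.X₂) :
    ∃ k : ℕ, y ^ k • z = 0 := by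
  obtain ⟨k, hk⟩ := h₃ (S.g z)
  obtain ⟨w, hw⟩ := (ShortComplex.moduleCat_exact_iff S).1 hS (y ^ k • z) (by rw [map_smul, hk])
  obtain ⟨l, hl⟩ := h₁ w
  exact ⟨l + k, by rw [pow_add, mul_smul, ← hw, ← map_smul, hl, map_zero]⟩

lemma exists_pow_smul_eq_zero_locAway (y : A) {M : ModuleCat.{0} A}
    (hM : ∀ m : M, ∃ k : ℕ, y ^ k • m = 0) (z : (locAway x).obj M) : ∃ k : ℕ, y ^ k • z = 0 := by
  obtain ⟨k, m, hk⟩ := exists_pow_smul_eq_toLocAway x M z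
  obtain ⟨l, hl⟩ := hM m
  have hb : ∀ n : ℕ, Function.Injective (fun z : (locAway x).obj M => x ^ n • z) := by
    intro n
    induction n with
    | zero => exact fun u v h => by simpa using h
    | succ n ih =>
      refine fun u v h => ih ((bijective_smul_resAway x ((extAway x).obj M)).1 ?_)
      simpa only [smul_smul, ← pow_succ'] using h
  refine ⟨l, hb k ?_⟩
  have h1 : y ^ l • (toLocAway x).app M m = (toLocAway x).app M (y ^ l • m) :=
    (map_smul ((toLocAway x).app M).hom _ _).symm
  change x ^ k • y ^ l • z = x ^ k • (0 : (locAway x).obj M)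
  rw [smul_comm, hk, h1, hl, smul_zero]
  exact map_zero ((toLocAway x).app M).hom

instance : PreservesFiniteColimits (extAway x) :=
  have := (ModuleCat.extendRestrictScalarsAdj (algebraMap A (Localization.Away x)))
    |>.leftAdjoint_preservesColimits
  inferInstance

instance : PreservesFiniteLimits (locAway x) := comp_preservesFiniteLimits _ _

instance : PreservesFiniteColimits (locAway x) := comp_preservesFiniteColimits _ _

instance : (locAway x).Additive := Functor.additive_of_preserves_binary_products _

instance : (locAway x).PreservesHomology := inferInstance

end Away

section Approximation

open Limits Triangulated Pretriangulated

open DerivedCategory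

variable {A : Type} [CommRing A] [HasDerivedCategory (ModuleCat.{0} A)]

/-- There is no nonzero morphism from `L` to shifts of `A`, nor from `a`-power torsion modules to
shifts of `L`. -/
def IsInvisible (a : Ideal A) (L : DerivedCategory (ModuleCat.{0} A)) : Prop :=
  (∀ (i : ℤ) (f : L ⟶ (singleFunctor (ModuleCat.{0} A) i).obj (ModuleCat.of A A)), f = 0) ∧
  ∀ (i : ℤ) (N : ModuleCat.{0} A), IsPowTorsion a N →
    ∀ f : (singleFunctor (ModuleCat.{0} A) i).obj N ⟶ L, f = 0

variable {a : Ideal A}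

lemma IsInvisible.of_isZero {L : DerivedCategory (ModuleCat.{0} A)}
    (hL : IsZero L) : IsInvisible a L :=
  ⟨fun _ _ => hL.eq_of_src _ _, fun _ _ _ _ => hL.eq_of_tgt _ _⟩

lemma IsInvisible.of_distTriang {T : Triangle (DerivedCategory (ModuleCat.{0} A))}
    (hT : T ∈ distTriang (DerivedCategory (ModuleCat.{0} A)))
    (h₁ : IsInvisible a T.obj₁) (h₃ : IsInvisible a T.obj₃) : IsInvisible a T.obj₂ := by
  refine ⟨fun i f => ?_, fun i N hN f => ?_⟩
  · obtain ⟨g, rfl⟩ := Triangle.yoneda_exact₂ _ hT f (h₁.1 _ _)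
    rw [h₃.1 _ g, comp_zero]
  · obtain ⟨g, rfl⟩ := Triangle.coyoneda_exact₂ _ hT f (h₃.2 _ _ hN _)
    rw [h₁.2 _ _ hN g, zero_comp]

lemma IsInvisible.shift {L : DerivedCategory (ModuleCat.{0} A)} (h : IsInvisible a L)
    (k : ℤ) : IsInvisible a (L⟦k⟧) := by
  refine ⟨fun i f => ?_, fun i N hN f => ?_⟩
  · obtain ⟨g, hg⟩ := (shiftFunctor (DerivedCategory (ModuleCat.{0} A)) k).map_surjective
      (f ≫ ((singleFunctors (ModuleCat.{0} A)).shiftIso k i (k + i) rfl).inv.app (ModuleCat.of A A))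
    rw [h.1 _ g, Functor.map_zero] at hg
    exact (cancel_mono _).1 (hg.symm.trans zero_comp.symm)
  · obtain ⟨g, rfl⟩ := (singleShift_bijective (k + i) k i rfl).2 f
    rw [h.2 _ _ hN g, singleShift, Functor.map_zero, comp_zero]

/-- The morphism `φ` cannot be distinguished from an isomorphism by morphisms into shifts of `A`,
nor by morphisms from shifts of `a`-power torsion modules. -/
structure IsTorsionApprox (a : Ideal A) {F S : DerivedCategory (ModuleCat.{0} A)}
    (φ : F ⟶ S) : Prop where
  precomp (i : ℤ) : Function.Bijective
    (fun f : S ⟶ (singleFunctor (ModuleCat.{0} A) i).obj (ModuleCat.of A A) => φ ≫ f)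
  postcomp (i : ℤ) (N : ModuleCat.{0} A) (hN : IsPowTorsion a N) : Function.Bijective
    (fun f : (singleFunctor (ModuleCat.{0} A) i).obj N ⟶ F => f ≫ φ)

lemma IsTorsionApprox.id (S : DerivedCategory (ModuleCat.{0} A)) : IsTorsionApprox a (𝟙 S) where
  precomp _ := ⟨fun f g h => by simpa using h, fun f => ⟨f, Category.id_comp f⟩⟩
  postcomp _ _ _ := ⟨fun f g h => by simpa using h, fun f => ⟨f, Category.comp_id f⟩⟩

lemma IsTorsionApprox.comp {E F S : DerivedCategory (ModuleCat.{0} A)} {ψ : E ⟶ F} {φ : F ⟶ S}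
    (h : IsTorsionApprox a ψ)
    (h' : IsTorsionApprox a φ) : IsTorsionApprox a (ψ ≫ φ) where
  precomp i := by
    simpa only [Function.comp_def, Category.assoc] using! (h.precomp i).comp (h'.precomp i)
  postcomp i N hN := by
    simpa only [Function.comp_def, Category.assoc] using!
      (h'.postcomp i N hN).comp (h.postcomp i N hN)

lemma IsTorsionApprox.of_distTriang {T : Triangle (DerivedCategory (ModuleCat.{0} A))}
    (hT : T ∈ distTriang (DerivedCategory (ModuleCat.{0} A)))
    (h₃ : IsInvisible a T.obj₃) : IsTorsionApprox a T.mor₁ where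
  precomp i := by
    refine ⟨fun f g hfg => ?_, fun f => ?_⟩
    · have h0 : T.mor₁ ≫ (f - g) = 0 := by rw [Preadditive.comp_sub]; exact sub_eq_zero.2 hfg
      obtain ⟨u, hu⟩ := Triangle.yoneda_exact₂ _ hT (f - g) h0
      rw [h₃.1 _ u, comp_zero] at hu
      exact sub_eq_zero.1 hu
    · obtain ⟨u, hu⟩ := Triangle.yoneda_exact₂ _ (inv_rot_of_distTriang _ hT) f
        ((h₃.shift (-1)).1 _ _)
      exact ⟨u, hu.symm⟩
  postcomp i N hN := by
    refine ⟨fun f g hfg => ?_, fun f => ?_⟩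
    · have h0 : (f - g) ≫ T.mor₁ = 0 := by rw [Preadditive.sub_comp]; exact sub_eq_zero.2 hfg
      obtain ⟨u, hu⟩ := Triangle.coyoneda_exact₂ _ (inv_rot_of_distTriang _ hT) (f - g) h0
      rw [(h₃.shift (-1)).2 _ _ hN u] at hu
      exact sub_eq_zero.1 (hu.trans zero_comp)
    · obtain ⟨u, hu⟩ := Triangle.coyoneda_exact₂ _ hT f (h₃.2 _ _ hN _)
      exact ⟨u, hu.symm⟩

variable {x : A}

lemma isInvisible_single_resAway (I : Ideal A) [IsAdicComplete I A] (hx : x ∈ I) (hxa : x ∈ a)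
    (N : ModuleCat.{0} (Localization.Away x)) (j : ℤ) :
    IsInvisible a ((singleFunctor (ModuleCat.{0} A) j).obj ((resAway x).obj N)) := by
  refine ⟨fun i => ?_, fun i M hM => ?_⟩
  · exact single_hom_eq_zero_of_ext
      (subsingleton_ext_of_isAdicComplete I hx (bijective_smul_resAway x N)) _ _
  · refine single_hom_eq_zero_of_ext (fun n => subsingleton_ext_resAway x (fun m => ?_) n N) _ _
    obtain ⟨k, hk⟩ := hM m
    exact ⟨k, hk _ (Ideal.pow_mem_pow hxa k)⟩

lemma IsInvisible.of_iso {L L' : DerivedCategory (ModuleCat.{0} A)} (e : L ≅ L')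
    (h : IsInvisible a L) : IsInvisible a L' :=
  ⟨fun i _ => (cancel_epi e.hom).1 ((h.1 i _).trans comp_zero.symm),
    fun i N hN _ => (cancel_mono e.inv).1 ((h.2 i N hN _).trans zero_comp.symm)⟩

/-- Every homology module of `F` is `y`-power torsion. -/
def HomologyIsTorsion (y : A) (F : DerivedCategory (ModuleCat.{0} A)) : Prop :=
  ∀ (j : ℤ) (z : (homologyFunctor (ModuleCat.{0} A) j).obj F), ∃ k : ℕ, y ^ k • z = 0

end Approximation

section Approximation

open Limits Triangulated Pretriangulated

open DerivedCategory

variable {A : Type} [CommRing A] [HasDerivedCategory (ModuleCat.{0} A)] {a : Ideal A} {x : A}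

lemma exists_isTorsionApprox_homologyIsTorsion (I : Ideal A) [IsAdicComplete I A] (hx : x ∈ I)
    (hxa : x ∈ a) (F : DerivedCategory (ModuleCat.{0} A)) (p q : ℤ) [F.IsGE p] [F.IsLE q] :
    ∃ (F' : DerivedCategory (ModuleCat.{0} A)) (α : F' ⟶ F), IsTorsionApprox a α ∧ F'.IsGE p ∧
      F'.IsLE (q + 1) ∧ HomologyIsTorsion x F' ∧
      ∀ y, HomologyIsTorsion y F → HomologyIsTorsion y F' := by
  obtain ⟨L, β, hβ⟩ := exists_hom_of_natTrans (locAway x) (toLocAway x) F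
  choose e he using hβ
  obtain ⟨F', α, γ, hT⟩ := distinguished_cocone_triangle₁ β
  have hGE : L.IsGE p := by
    rw [isGE_iff]
    exact fun i hi => (Functor.map_isZero _ (isZero_of_isGE F p i hi)).of_iso (e i)
  have hLE : L.IsLE q := by
    rw [isLE_iff]
    exact fun i hi => (Functor.map_isZero _ (isZero_of_isLE F q i hi)).of_iso (e i)
  have hL : IsInvisible a L := by
    have hLE' : L.IsLE (p + (q + 1 - p).toNat - 1) :=
      TStructure.t.isLE_of_le L q _ (by lia)
    refine devissage _ (fun _ => IsInvisible.of_isZero) (fun T hT => IsInvisible.of_distTriang hT) _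
      p L hGE hLE' ?_
    rintro j Y ⟨u⟩
    exact (isInvisible_single_resAway I hx hxa
      ((extAway x).obj ((homologyFunctor (ModuleCat.{0} A) j).obj F)) j).of_iso
        ((singleFunctor _ j).mapIso (u ≪≫ e j).symm)
  have key (j : ℤ) := HomologySequence.exact₁ _ hT (j - 1) j
  refine ⟨F', α, IsTorsionApprox.of_distTriang hT hL, ?_, ?_, ?_, ?_⟩
  · rw [isGE_iff]
    exact fun i hi => (key i).isZero_of_both_zeros
      ((isZero_of_isGE L p _ (by lia)).eq_of_src _ _)
      ((isZero_of_isGE F p i hi).eq_of_tgt _ _)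
  · rw [isLE_iff]
    exact fun i hi => (key i).isZero_of_both_zeros
      ((isZero_of_isLE L q _ (by lia)).eq_of_src _ _)
      ((isZero_of_isLE F q i (by lia)).eq_of_tgt _ _)
  · intro j z
    have hex {S : ShortComplex (ModuleCat.{0} A)} (hS : S.Exact) :=
      (ShortComplex.moduleCat_exact_iff S).1 hS
    let αj := (homologyFunctor (ModuleCat.{0} A) j).map α
    let δj : (homologyFunctor _ (j - 1)).obj L ⟶ (homologyFunctor _ j).obj F' :=
      HomologySequence.δ (Triangle.mk α β γ) (j - 1) j
    have h1 : (toLocAway x).app _ (αj z) = 0 := by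
      rw [← he j, ModuleCat.comp_apply]
      have h0 : αj ≫ (homologyFunctor (ModuleCat.{0} A) j).map β = 0 := by
        rw [← Functor.map_comp]
        exact (congrArg _ (comp_distTriang_mor_zero₁₂ _ hT)).trans (Functor.map_zero _ _ _)
      have h0' := ConcreteCategory.congr_hom h0 z
      exact (congrArg _ h0').trans (map_zero (e j).hom.hom)
    obtain ⟨k, hk⟩ := exists_pow_smul_eq_zero_of_toLocAway_eq_zero x h1
    obtain ⟨w, hw⟩ : ∃ w, δj w = x ^ k • z :=
      hex (key j) (x ^ k • z) ((map_smul αj.hom _ _).trans hk)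
    obtain ⟨n, v, hv⟩ := exists_pow_smul_eq_toLocAway x _ ((e (j - 1)).hom w)
    have h2 : (homologyFunctor (ModuleCat.{0} A) (j - 1)).map β v = x ^ n • w := by
      have hi : Function.Injective (e (j - 1)).hom := (e (j - 1)).toLinearEquiv.injective
      apply hi
      rw [map_smul, hv, ← he (j - 1), ModuleCat.comp_apply]
    have h3 : (homologyFunctor (ModuleCat.{0} A) (j - 1)).map β ≫ δj = 0 :=
      HomologySequence.comp_δ _ hT (j - 1) j (by lia)
    refine ⟨n + k, ?_⟩
    have h4 : δj (x ^ n • w) = x ^ n • δj w := map_smul δj.hom _ _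
    rw [pow_add, mul_smul, ← hw, ← h4, ← h2]
    exact ConcreteCategory.congr_hom h3 v
  · intro y hy j z
    refine pow_torsion_of_exact y (key j) (fun w => ?_) (hy j) z
    obtain ⟨k, hk⟩ := exists_pow_smul_eq_zero_locAway x y (hy (j - 1)) ((e (j - 1)).hom w)
    refine ⟨k, ?_⟩
    have h1 : (e (j - 1)).inv ((e (j - 1)).hom (y ^ k • w)) = y ^ k • w :=
      (e (j - 1)).hom_inv_id_apply _
    have h2 : (e (j - 1)).hom (y ^ k • w) = y ^ k • (e (j - 1)).hom w := map_smul _ _ _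
    rw [h2, hk, map_zero] at h1
    exact h1.symm

lemma exists_isTorsionApprox (I : Ideal A) [IsAdicComplete I A] (s : Finset A)
    (S : DerivedCategory (ModuleCat.{0} A)) (p₀ q₀ : ℤ) [S.IsGE p₀] [S.IsLE q₀]
    (hs : ∀ y ∈ s, y ∈ I ∧ y ∈ a) :
    ∃ (F : DerivedCategory (ModuleCat.{0} A)) (φ : F ⟶ S), IsTorsionApprox a φ ∧
      F.IsGE p₀ ∧ (∃ q, F.IsLE q) ∧ ∀ y ∈ s, HomologyIsTorsion y F := by
  classical
  induction s using Finset.induction_on with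
  | empty => exact ⟨S, 𝟙 S, IsTorsionApprox.id S, inferInstance, ⟨q₀, inferInstance⟩, by simp⟩
  | insert y s _ ih =>
    obtain ⟨F, φ, hφ, _, ⟨q, _⟩, hF⟩ := ih fun z hz => hs z (Finset.mem_insert_of_mem hz)
    obtain ⟨hy, hya⟩ := hs y (Finset.mem_insert_self y s)
    obtain ⟨F', α, hα, h1, h2, h3, h4⟩ := exists_isTorsionApprox_homologyIsTorsion I hy hya F p₀ q
    refine ⟨F', α ≫ φ, hα.comp hφ, h1, ⟨_, h2⟩, fun z hz => ?_⟩
    rcases Finset.mem_insert.1 hz with rfl | hz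
    · exact h3
    · exact h4 z (hF z hz)

end Approximation

section Vanishing

open Limits Triangulated Pretriangulated

open DerivedCategory

variable {A : Type} [CommRing A] [HasDerivedCategory (ModuleCat.{0} A)] {a : Ideal A}

/-- If the lowest homology module of `X` is torsion, it vanishes as soon as all morphisms
out of shifts of the `A / a ^ t` eventually vanish. -/
lemma isGE_succ_of_eventually_eq_zero (X : DerivedCategory (ModuleCat.{0} A)) (p : ℤ) [X.IsGE p]
    (hX : IsPowTorsion a ((homologyFunctor (ModuleCat.{0} A) p).obj X))
    (hv : ∀ (t : ℕ) (v : (singleFunctor (ModuleCat.{0} A) p).obj (quo a t) ⟶ X),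
      ∃ (s : ℕ) (h : t ≤ s), (singleFunctor _ p).map (quoMap a h) ≫ v = 0) :
    X.IsGE (p + 1) := by
  obtain ⟨Y, B, f, g, h, hT, hB, ⟨e⟩, hg, hf⟩ := exists_truncation X p
  have hY : Subsingleton Y := by
    refine subsingleton_of_forall_eq 0 fun y => ?_
    obtain ⟨k, hk⟩ := hX.of_surjective e.inv.hom e.symm.toLinearEquiv.surjective y
    obtain ⟨s, hs, h0⟩ := hv k ((singleFunctor _ p).map (quoDesc a y hk) ≫ f)
    rw [← Category.assoc, ← Functor.map_comp] at h0
    have h1 := ConcreteCategory.congr_hom (hf _ _ h0) (1 : A ⧸ a ^ s)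
    rw [ModuleCat.comp_apply, quoMap_one, quoDesc_one] at h1
    exact h1
  have hz : IsZero ((homologyFunctor (ModuleCat.{0} A) p).obj X) :=
    (ModuleCat.isZero_of_subsingleton Y).of_iso e.symm
  rw [isGE_iff]
  intro i hi
  rcases (Int.lt_add_one_iff.1 hi).lt_or_eq with hi | rfl
  · exact isZero_of_isGE X p i hi
  · exact hz

lemma exists_single_map_quoMap_comp_eq_zero [IsNoetherianRing A] (H : ModuleCat.{0} A)
    (hH : IsPowTorsion a H) (p c : ℤ) (hpc : c ≤ p) (t : ℕ)
    (v : (singleFunctor (ModuleCat.{0} A) p).obj (quo a t) ⟶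
      ((singleFunctor (ModuleCat.{0} A) c).obj H)⟦(1 : ℤ)⟧) :
    ∃ (s : ℕ) (h : t ≤ s), (singleFunctor _ p).map (quoMap a h) ≫ v = 0 := by
  obtain ⟨n, rfl⟩ : ∃ n : ℕ, p = n + c := ⟨(p - c).toNat, by lia⟩
  let Z := ((singleFunctor (ModuleCat.{0} A) c).obj H)⟦(1 : ℤ)⟧
  let e : Z⟦(n + c : ℤ)⟧ ≅ ((singleFunctor (ModuleCat.{0} A) 0).obj H)⟦((n + 1 : ℕ) : ℤ)⟧ :=
    ((shiftFunctorAdd' (DerivedCategory (ModuleCat.{0} A)) 1 (n + c) (n + 1 + c) (by lia)).app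
      _).symm ≪≫
    (shiftFunctorAdd' (DerivedCategory (ModuleCat.{0} A)) c ((n + 1 : ℕ) : ℤ) (n + 1 + c)
      (by push_cast; lia)).app _ ≪≫
    (shiftFunctor _ ((n + 1 : ℕ) : ℤ)).mapIso
      (((singleFunctors (ModuleCat.{0} A)).shiftIso c 0 c (by lia)).app H)
  let x : Abelian.Ext (quo a t) H (n + 1) :=
    Abelian.Ext.homEquiv.symm (singleShift (n + c) (n + c) 0 (by lia) v ≫ e.hom)
  obtain ⟨s, h, hs⟩ := exists_quoMap_comp_eq_zero a n H hH t x
  refine ⟨s, h, ?_⟩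
  apply (singleShift_bijective (n + c) (n + c) 0 (by lia)).1
  rw [singleShift_comp]
  have h1 := congrArg Abelian.Ext.hom hs
  rw [Abelian.Ext.comp_hom, Abelian.Ext.mk₀_hom, ShiftedHom.mk₀_comp] at h1
  have h2 : x.hom = singleShift (n + c) (n + c) 0 (by lia) v ≫ e.hom :=
    Abelian.Ext.homEquiv.apply_symm_apply _
  rw [h2, Abelian.Ext.zero_hom, ← Category.assoc] at h1
  rw [(cancel_mono e.hom).1 (h1.trans zero_comp.symm)]
  simp [singleShift]

/-- A torsion approximation of an object with eventually vanishing extension classes outside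
degree `c` is concentrated in degree `c`. -/
lemma exists_iso_single_of_isTorsionApprox [IsNoetherianRing A]
    {F S : DerivedCategory (ModuleCat.{0} A)} (φ : F ⟶ S) (hφ : IsTorsionApprox a φ) (p₀ q : ℤ)
    [F.IsGE p₀] [F.IsLE q]
    (hF : ∀ j, IsPowTorsion a ((homologyFunctor (ModuleCat.{0} A) j).obj F)) (c : ℤ)
    (hS : ∀ (p : ℤ) (_ : p ≠ c) (t : ℕ)
      (v : (singleFunctor (ModuleCat.{0} A) p).obj (quo a t) ⟶ S),
      ∃ (s : ℕ) (h : t ≤ s), (singleFunctor _ p).map (quoMap a h) ≫ v = 0) :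
    ∃ (H : ModuleCat.{0} A) (_ : (singleFunctor (ModuleCat.{0} A) c).obj H ≅ F),
      IsPowTorsion a H := by
  have hFS (p : ℤ) (hp : p ≠ c) (t : ℕ)
      (v : (singleFunctor (ModuleCat.{0} A) p).obj (quo a t) ⟶ F) :
      ∃ (s : ℕ) (h : t ≤ s), (singleFunctor _ p).map (quoMap a h) ≫ v = 0 := by
    obtain ⟨s, h, hs⟩ := hS p hp t (v ≫ φ)
    refine ⟨s, h, (hφ.postcomp p _ (quo_isPowTorsion a s)).1 ?_⟩
    exact (Category.assoc _ _ _).trans (hs.trans zero_comp.symm)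
  have hc : F.IsGE c := by
    rcases le_total c p₀ with h | h
    · exact TStructure.t.isGE_of_ge F c p₀ h
    · obtain ⟨n, hn⟩ := Int.eq_ofNat_of_zero_le (sub_nonneg.2 h)
      have (m : ℕ) (hm : p₀ + m ≤ c) : F.IsGE (p₀ + m) := by
        induction m with
        | zero => simpa
        | succ m ih =>
          have := ih (by lia)
          have h1 := isGE_succ_of_eventually_eq_zero F (p₀ + m) (hF _) (hFS _ (by lia))
          rwa [Nat.cast_succ, ← add_assoc]
      have h1 := this n (by lia)
      rwa [show p₀ + (n : ℤ) = c by lia] at h1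
  obtain ⟨H, B, f, g, h, hT, hB, ⟨e⟩, hg, hf⟩ := exists_truncation F c
  have hH : IsPowTorsion a H := (hF c).of_surjective e.inv.hom e.symm.toLinearEquiv.surjective
  have hBv (p : ℤ) (hp : c < p) (t : ℕ)
      (v : (singleFunctor (ModuleCat.{0} A) p).obj (quo a t) ⟶ B) :
      ∃ (s : ℕ) (h : t ≤ s), (singleFunctor _ p).map (quoMap a h) ≫ v = 0 := by
    obtain ⟨s, hs, h0⟩ := exists_single_map_quoMap_comp_eq_zero H hH p c hp.le t (v ≫ h)
    rw [← Category.assoc] at h0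
    obtain ⟨w, hw⟩ : ∃ w : _ ⟶ F, (singleFunctor _ p).map (quoMap a hs) ≫ v = w ≫ g :=
      Triangle.coyoneda_exact₃ _ hT _ h0
    obtain ⟨r, hr, h1⟩ := hFS p hp.ne' s w
    refine ⟨r, hs.trans hr, ?_⟩
    rw [← quoMap_comp a hs hr, Functor.map_comp, Category.assoc, hw,
      ← Category.assoc, h1, zero_comp]
  have hBt (p : ℤ) (hp : c < p) : IsPowTorsion a ((homologyFunctor (ModuleCat.{0} A) p).obj B) := by
    have := hg p hp
    let u := asIso ((homologyFunctor (ModuleCat.{0} A) p).map g)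
    exact (hF p).of_surjective u.hom.hom u.toLinearEquiv.surjective
  have hBz : IsZero B := by
    have hBge (m : ℕ) : B.IsGE (c + 1 + m) := by
      induction m with
      | zero => simpa
      | succ m ih =>
        have h1 := isGE_succ_of_eventually_eq_zero B (c + 1 + m) (hBt _ (by lia))
          (hBv _ (by lia))
        rwa [Nat.cast_succ, ← add_assoc]
    have hBle : B.IsLE (max c q) := by
      rw [isLE_iff]
      intro i hi
      have := hg i (by lia)
      exact (isZero_of_isLE F q i (by lia)).of_iso
        (asIso ((homologyFunctor (ModuleCat.{0} A) i).map g)).symm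
    have := hBge (max c q - c).toNat
    exact isZero_of_isGE_of_isLE B (c + 1 + (max c q - c).toNat) (max c q) (by lia)
  have hiso : IsIso f := (Triangle.isZero₃_iff_isIso₁ _ hT).1 hBz
  exact ⟨H, asIso f, hH⟩

end Vanishing

section Comparison

open Limits Triangulated Pretriangulated

open Opposite

variable {R : Type} [CommRing R] {X X' : ModuleCat.{0} R}

/-- The complex of morphisms from a projective resolution, as a chain complex in the opposite
category. -/
noncomputable abbrev homComplex (P : ProjectiveResolution X) (Y : ModuleCat.{0} R) :
    ChainComplex (ModuleCat.{0} R)ᵒᵖ ℕ :=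
  (((linearYoneda R (ModuleCat.{0} R)).obj Y).rightOp.mapHomologicalComplex _).obj P.complex

/-- Degree `n` cocycles of the complex of morphisms from a projective resolution. -/
noncomputable def cocycles (P : ProjectiveResolution X) (Y : ModuleCat.{0} R) (n : ℕ) :
    ModuleCat.{0} R :=
  ((homComplex P Y).opcycles n).unop

/-- The inclusion of cocycles into cochains. -/
noncomputable def cocyclesι (P : ProjectiveResolution X) (Y : ModuleCat.{0} R) (n : ℕ) :
    cocycles P Y n →ₗ[R] (P.complex.X n ⟶ Y) :=
  (show cocycles P Y n ⟶ ModuleCat.of R (P.complex.X n ⟶ Y) from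
    ((homComplex P Y).pOpcycles n).unop).hom

/-- The projection from cocycles to cohomology. -/
noncomputable def cocyclesπ (P : ProjectiveResolution X) (Y : ModuleCat.{0} R) (n : ℕ) :
    cocycles P Y n ⟶ ((Ext R (ModuleCat.{0} R) n).obj (op X)).obj Y :=
  ((homComplex P Y).homologyι n).unop ≫
    (P.isoLeftDerivedObj ((linearYoneda R (ModuleCat.{0} R)).obj Y).rightOp n).hom.unop

variable (P : ProjectiveResolution X) (P' : ProjectiveResolution X') (Y : ModuleCat.{0} R) (n : ℕ)

lemma cocyclesι_injective : Function.Injective (cocyclesι P Y n) :=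
  (ModuleCat.mono_iff_injective ((homComplex P Y).pOpcycles n).unop).1 inferInstance

lemma d_comp_cocyclesι (m : ℕ) (z : cocycles P Y n) : P.complex.d m n ≫ cocyclesι P Y n z = 0 :=
  ConcreteCategory.congr_hom (congrArg Quiver.Hom.unop ((homComplex P Y).d_pOpcycles m n)) z

lemma exists_cocyclesι_eq (f : P.complex.X n ⟶ Y) (hf : P.complex.d (n + 1) n ≫ f = 0) :
    ∃ z, cocyclesι P Y n z = f := by
  have h := ShortComplex.exact_of_g_is_cokernel
    (ShortComplex.mk _ _ ((homComplex P Y).d_pOpcycles (n + 1) n))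
    ((homComplex P Y).opcyclesIsCokernel (n + 1) n (by simp))
  exact (ShortComplex.moduleCat_exact_iff _).1 h.unop f hf

lemma cocyclesπ_surjective : Function.Surjective (cocyclesπ P Y n) := by
  rw [← ModuleCat.epi_iff_surjective]
  have : Mono ((homComplex P Y).homologyι n) := inferInstance
  have : Epi ((homComplex P Y).homologyι n).unop := unop_epi_of_mono _
  have h : Epi (P.isoLeftDerivedObj
      ((linearYoneda R (ModuleCat.{0} R)).obj Y).rightOp n).hom.unop := inferInstance
  exact @epi_comp _ _ _ _ _ _ this _ h

lemma cocyclesπ_eq_zero_iff (z : cocycles P Y n) :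
    cocyclesπ P Y n z = 0 ↔ ((homComplex P Y).homologyι n).unop z = 0 := by
  have h : Function.Injective (P.isoLeftDerivedObj
      ((linearYoneda R (ModuleCat.{0} R)).obj Y).rightOp n).unop.hom :=
    (P.isoLeftDerivedObj ((linearYoneda R (ModuleCat.{0} R)).obj Y).rightOp
      n).unop.toLinearEquiv.injective
  exact map_eq_zero_iff _ h

lemma cocyclesπ_succ_eq_zero_iff (z : cocycles P Y (n + 1)) :
    cocyclesπ P Y (n + 1) z = 0 ↔
      ∃ g : P.complex.X n ⟶ Y, P.complex.d (n + 1) n ≫ g = cocyclesι P Y (n + 1) z := by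
  have h := (ShortComplex.exact_of_f_is_kernel
    (ShortComplex.mk _ _ ((homComplex P Y).homologyι_comp_fromOpcycles (n + 1) n))
    ((homComplex P Y).homologyIsKernel (n + 1) n (by simp))).unop
  have h' := (ShortComplex.moduleCat_exact_iff _).1 h
  rw [cocyclesπ_eq_zero_iff]
  have h1 (g : P.complex.X n ⟶ Y) : cocyclesι P Y (n + 1)
      (((homComplex P Y).fromOpcycles (n + 1) n).unop g) = P.complex.d (n + 1) n ≫ g :=
    ConcreteCategory.congr_hom (congrArg Quiver.Hom.unop
      ((homComplex P Y).p_fromOpcycles (n + 1) n)) g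
  constructor
  · intro hz
    obtain ⟨g, hg⟩ := h' z hz
    exact ⟨g, (h1 g).symm.trans (congrArg _ hg)⟩
  · rintro ⟨g, hg⟩
    rw [← h1 g] at hg
    rw [← cocyclesι_injective P Y (n + 1) hg]
    exact ConcreteCategory.congr_hom (congrArg Quiver.Hom.unop
      ((homComplex P Y).homologyι_comp_fromOpcycles (n + 1) n)) g

lemma cocyclesπ_zero_eq_zero_iff (z : cocycles P Y 0) : cocyclesπ P Y 0 z = 0 ↔ z = 0 := by
  rw [cocyclesπ_eq_zero_iff]
  have : IsIso ((homComplex P Y).homologyι 0) :=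
    (homComplex P Y).isIso_homologyι 0 _ rfl ((homComplex P Y).shape _ _ (by simp))
  have h : Function.Injective ((homComplex P Y).homologyι 0).unop :=
    (asIso ((homComplex P Y).homologyι 0)).unop.toLinearEquiv.injective
  exact map_eq_zero_iff _ h

variable {Y n} in
lemma exists_cocycles_map {P : ProjectiveResolution X} {P' : ProjectiveResolution X'} {φ : X' ⟶ X}
    (ψ : ProjectiveResolution.Hom P' P φ) (z : cocycles P Y n) :
    ∃ z' : cocycles P' Y n, cocyclesι P' Y n z' = ψ.hom.f n ≫ cocyclesι P Y n z ∧
      cocyclesπ P' Y n z' = ((Ext R (ModuleCat.{0} R) n).map φ.op).app Y (cocyclesπ P Y n z) := by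
  let G := (((linearYoneda R (ModuleCat.{0} R)).obj Y).rightOp.mapHomologicalComplex
    (ComplexShape.down ℕ)).map ψ.hom
  refine ⟨(HomologicalComplex.opcyclesMap G n).unop z, ?_, ?_⟩
  · exact ConcreteCategory.congr_hom (congrArg Quiver.Hom.unop
      (HomologicalComplex.p_opcyclesMap G n)) z
  · have h1 := P'.isoLeftDerivedObj_hom_naturality φ P ψ.hom ψ.hom_f_zero_comp_π_f_zero
      ((linearYoneda R (ModuleCat.{0} R)).obj Y).rightOp n
    have h2 := HomologicalComplex.homologyι_naturality G n
    have h3 := ((Category.assoc _ _ _).symm.trans (congrArg (· ≫ (homComplex P Y).homologyι n)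
      h1)).trans ((Category.assoc _ _ _).trans (congrArg (_ ≫ ·) h2))
    exact (ConcreteCategory.congr_hom (congrArg Quiver.Hom.unop h3) z).symm

end Comparison

section Comparison

open Limits Triangulated Pretriangulated

open Opposite

lemma extMk_zero_eq_zero_iff {C : Type*} [Category C] [Abelian C] [HasExt C] {X Y : C}
    (P : ProjectiveResolution X) (f : P.complex.X 0 ⟶ Y) (hf : P.complex.d 1 0 ≫ f = 0) :
    P.extMk f 1 rfl hf = 0 ↔ f = 0 := by
  simp only [← P.extEquivCohomologyClass.apply_eq_iff_eq,
    ProjectiveResolution.extEquivCohomologyClass_extMk,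
    ProjectiveResolution.extEquivCohomologyClass_zero,
    CochainComplex.HomComplex.CohomologyClass.mk_eq_zero_iff]
  rw [CochainComplex.HomComplex.Cocycle.toSingleMk_mem_coboundaries_iff _ _ _ _ _ 1 (by simp)]
  have hz : IsZero (P.cochainComplex.X 1) := CochainComplex.isZero_of_isStrictlyLE _ 0 1
  refine ⟨fun ⟨g, hg⟩ => ?_, fun h => ⟨0, by simp [h]⟩⟩
  rw [hz.eq_of_src g 0, comp_zero] at hg
  exact (cancel_epi (P.cochainComplexXIso (-(0 : ℕ)) 0 rfl).hom).1 (hg.symm.trans comp_zero.symm)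

variable {R : Type} [CommRing R] {X X' : ModuleCat.{0} R}
  (P : ProjectiveResolution X) (P' : ProjectiveResolution X') (Y : ModuleCat.{0} R) (n : ℕ)

/-- The extension class of a cocycle. -/
noncomputable def cocyclesExt : cocycles P Y n →ₗ[R] Abelian.Ext X Y n where
  toFun z := P.extMk (cocyclesι P Y n z) (n + 1) rfl (d_comp_cocyclesι P Y n _ z)
  map_add' z w := by simp only [map_add, ProjectiveResolution.add_extMk]
  map_smul' r z := by
    have h : cocyclesι P Y n (r • z) = cocyclesι P Y n z ≫ (r • 𝟙 Y) := by simp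
    simp only [h, RingHom.id_apply]
    rw [← ProjectiveResolution.extMk_comp_mk₀ _ _ _ _ (d_comp_cocyclesι P Y n _ z),
      Abelian.Ext.mk₀_smul, Abelian.Ext.comp_smul, Abelian.Ext.comp_mk₀_id]

lemma cocyclesExt_surjective : Function.Surjective (cocyclesExt P Y n) := by
  intro α
  obtain ⟨f, hf, rfl⟩ := P.extMk_surjective α (n + 1) rfl
  obtain ⟨z, rfl⟩ := exists_cocyclesι_eq P Y n f hf
  exact ⟨z, rfl⟩

lemma ker_cocyclesExt :
    LinearMap.ker (cocyclesExt P Y n) = LinearMap.ker (cocyclesπ P Y n).hom := by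
  ext z
  rw [LinearMap.mem_ker, LinearMap.mem_ker]
  cases n with
  | zero =>
    exact ((extMk_zero_eq_zero_iff P _ (d_comp_cocyclesι P Y 0 _ z)).trans
      (map_eq_zero_iff _ (cocyclesι_injective P Y 0))).trans
      (cocyclesπ_zero_eq_zero_iff P Y z).symm
  | succ n =>
    exact (P.extMk_eq_zero_iff _ _ rfl (d_comp_cocyclesι P Y _ _ z) n rfl).trans
      (cocyclesπ_succ_eq_zero_iff P Y n z).symm

/-- The comparison between the two constructions of extension modules. -/
noncomputable def extEquivOfResolution :
    ((Ext R (ModuleCat.{0} R) n).obj (op X)).obj Y ≃ₗ[R] Abelian.Ext X Y n :=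
  ((cocyclesπ P Y n).hom.quotKerEquivOfSurjective (cocyclesπ_surjective P Y n)).symm ≪≫ₗ
    Submodule.quotEquivOfEq _ _ (ker_cocyclesExt P Y n).symm ≪≫ₗ
    (cocyclesExt P Y n).quotKerEquivOfSurjective (cocyclesExt_surjective P Y n)

lemma extEquivOfResolution_cocyclesπ (z : cocycles P Y n) :
    extEquivOfResolution P Y n (cocyclesπ P Y n z) = cocyclesExt P Y n z := by
  have h : ((cocyclesπ P Y n).hom.quotKerEquivOfSurjective (cocyclesπ_surjective P Y n)).symm
      (cocyclesπ P Y n z) = Submodule.Quotient.mk z := by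
    rw [LinearEquiv.symm_apply_eq]
    rfl
  rw [extEquivOfResolution, LinearEquiv.trans_apply, LinearEquiv.trans_apply, h]
  rfl

lemma exists_extEquiv (Y : ModuleCat.{0} R) (n : ℕ) :
    ∃ e : ∀ X : ModuleCat.{0} R,
      ((Ext R (ModuleCat.{0} R) n).obj (op X)).obj Y ≃ₗ[R] Abelian.Ext X Y n,
      ∀ (X X' : ModuleCat.{0} R) (φ : X' ⟶ X) (x),
        e X' (((Ext R (ModuleCat.{0} R) n).map φ.op).app Y x) =
          (Abelian.Ext.mk₀ φ).comp (e X x) (zero_add n) := by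
  refine ⟨fun X => extEquivOfResolution (projectiveResolution X) Y n, fun X X' φ x => ?_⟩
  obtain ⟨z, rfl⟩ := cocyclesπ_surjective (projectiveResolution X) Y n x
  let ψ : ProjectiveResolution.Hom (projectiveResolution X') (projectiveResolution X) φ :=
    ⟨ProjectiveResolution.lift φ _ _, ProjectiveResolution.lift_commutes_zero _ _ _⟩
  obtain ⟨z', h1, h2⟩ := exists_cocycles_map ψ z
  rw [← h2, extEquivOfResolution_cocyclesπ, extEquivOfResolution_cocyclesπ]
  have h3 := ProjectiveResolution.mk₀_comp_extMk _ _ rfl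
    (d_comp_cocyclesι (projectiveResolution X) Y n _ z) ψ
  refine Eq.trans ?_ h3.symm
  simp only [← h1]
  rfl

end Comparison

section LocalCohomology

open Limits Triangulated Pretriangulated

open Opposite DerivedCategory

variable {A : Type} [CommRing A]

lemma exists_map_eq_zero_of_isColimit {J : Type} [SmallCategory J] [IsFiltered J]
    {D : J ⥤ ModuleCat.{0} A} {K : Cocone D} (hK : IsColimit K) {j : J} (x : D.obj j)
    (hx : K.ι.app j x = 0) : ∃ (k : J) (f : j ⟶ k), D.map f x = 0 := by
  obtain ⟨k, f, g, h⟩ := Concrete.isColimit_exists_of_rep_eq D hK x (0 : D.obj j)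
    (hx.trans (map_zero (K.ι.app j).hom).symm)
  exact ⟨k, f, h.trans (map_zero (D.map g).hom)⟩

/-- Local cohomology is the directed union of the images of the extension modules of the
`A / a ^ t`. -/
lemma exists_localCohomology_maps (a : Ideal A) (i : ℕ) (M : ModuleCat.{0} A) :
    ∃ ι : ∀ t, ((Ext A (ModuleCat.{0} A) i).obj (op (quo a t))).obj M ⟶
        (localCohomology a i).obj M,
      (∀ (t s : ℕ) (h : t ≤ s),
        ((Ext A (ModuleCat.{0} A) i).map (quoMap a h).op).app M ≫ ι s = ι t) ∧
      (∀ y, ∃ t x, ι t x = y) ∧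
      ∀ t x, ι t x = 0 → ∃ (s : ℕ) (h : t ≤ s),
        ((Ext A (ModuleCat.{0} A) i).map (quoMap a h).op).app M x = 0 := by
  let D := localCohomology.diagram (localCohomology.idealPowersDiagram a) i
  let ev := (evaluation (ModuleCat.{0} A) (ModuleCat.{0} A)).obj M
  let hc : IsColimit (ev.mapCocone (colimit.cocone D)) :=
    isColimitOfPreserves ev (colimit.isColimit D)
  refine ⟨fun t => (ev.mapCocone (colimit.cocone D)).ι.app (op (op t)), fun t s h => ?_,
    fun y => ?_, fun t x hx => ?_⟩
  · exact (ev.mapCocone (colimit.cocone D)).w (homOfLE h).op.op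
  · obtain ⟨t, x, hx⟩ := Concrete.isColimit_exists_rep (D ⋙ ev) hc y
    exact ⟨t.unop.unop, x, hx⟩
  · obtain ⟨s, f, h⟩ := exists_map_eq_zero_of_isColimit hc (j := op (op t)) x hx
    exact ⟨s.unop.unop, leOfHom f.unop.unop, h⟩

variable [HasDerivedCategory (ModuleCat.{0} A)]

/-- Local cohomology is the directed union of the images of groups of morphisms in the derived
category. -/
lemma exists_localCohomology_hom_maps (a : Ideal A) (i : ℕ) (M : ModuleCat.{0} A) :
    ∃ ι : ∀ t, ((singleFunctor (ModuleCat.{0} A) i).obj (quo a t) ⟶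
        (singleFunctor (ModuleCat.{0} A) 0).obj M) →ₗ[A] (localCohomology a i).obj M,
      (∀ (t s : ℕ) (h : t ≤ s) (x), ι s ((singleFunctor _ (i : ℤ)).map (quoMap a h) ≫ x) = ι t x) ∧
      (∀ y, ∃ t x, ι t x = y) ∧
      ∀ t x, ι t x = 0 → ∃ (s : ℕ) (h : t ≤ s),
        (singleFunctor _ (i : ℤ)).map (quoMap a h) ≫ x = 0 := by
  obtain ⟨ι, h1, h2, h3⟩ := exists_localCohomology_maps a i M
  obtain ⟨e, he⟩ := exists_extEquiv M i
  let σ (X : ModuleCat.{0} A) : ((singleFunctor (ModuleCat.{0} A) i).obj X ⟶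
      (singleFunctor (ModuleCat.{0} A) 0).obj M) ≃ₗ[A]
      ((Ext A (ModuleCat.{0} A) i).obj (op X)).obj M :=
    (LinearEquiv.ofBijective
      (⟨⟨singleShift (i : ℤ) i 0 (by lia), singleShift_add _ _ _ _⟩, singleShift_smul _ _ _ _⟩ :
        _ →ₗ[A] ShiftedHom ((singleFunctor _ 0).obj X) ((singleFunctor _ 0).obj M) (i : ℤ))
      (singleShift_bijective _ _ _ _)) ≪≫ₗ Abelian.Ext.homLinearEquiv.symm ≪≫ₗ (e X).symm
  have hσ (X X' : ModuleCat.{0} A) (φ : X' ⟶ X) (x) :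
      σ X' ((singleFunctor _ (i : ℤ)).map φ ≫ x) =
        ((Ext A (ModuleCat.{0} A) i).map φ.op).app M (σ X x) := by
    apply (e X').injective
    rw [he]
    apply (Abelian.Ext.homLinearEquiv (R := A)).injective
    have h1 (Y : ModuleCat.{0} A) (y) : e Y (σ Y y) =
        Abelian.Ext.homLinearEquiv.symm (singleShift (i : ℤ) i 0 (by lia) y) :=
      (e Y).apply_symm_apply _
    rw [h1, h1, LinearEquiv.apply_symm_apply, singleShift_comp]
    refine Eq.trans ?_ (Abelian.Ext.comp_hom _ _ _).symm
    rw [Abelian.Ext.mk₀_hom, ShiftedHom.mk₀_comp]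
    exact congrArg _ ((Abelian.Ext.homLinearEquiv (R := A)).apply_symm_apply _).symm
  refine ⟨fun t => (ι t).hom ∘ₗ (σ (quo a t)).toLinearMap, fun t s h x => ?_, fun y => ?_,
    fun t x hx => ?_⟩
  · refine (congrArg (ι s) (hσ _ _ _ _)).trans ?_
    exact ConcreteCategory.congr_hom (h1 t s h) (σ _ x)
  · obtain ⟨t, x, rfl⟩ := h2 y
    exact ⟨t, (σ _).symm x, congrArg (ι t) ((σ _).apply_symm_apply x)⟩
  · obtain ⟨s, h, h0⟩ := h3 t (σ _ x) hx
    refine ⟨s, h, (σ _).injective ?_⟩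
    rw [hσ, h0, map_zero]

/-- A torsion approximation by a single module identifies that module with local cohomology. -/
lemma nonempty_linearEquiv_localCohomology (a : Ideal A) (c : ℕ) (M H : ModuleCat.{0} A)
    (hH : IsPowTorsion a H) (φ : (singleFunctor (ModuleCat.{0} A) c).obj H ⟶
      (singleFunctor (ModuleCat.{0} A) 0).obj M) (hφ : IsTorsionApprox a φ) :
    Nonempty (H ≃ₗ[A] (localCohomology a c).obj M) := by
  obtain ⟨ι, h1, h2, h3⟩ := exists_localCohomology_hom_maps a c M
  let j (t : ℕ) (u : quo a t ⟶ H) := ι t ((singleFunctor _ (c : ℤ)).map u ≫ φ)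
  have hj (t s : ℕ) (h : t ≤ s) (u : quo a t ⟶ H) : j s (quoMap a h ≫ u) = j t u := by
    simp only [j, Functor.map_comp, Category.assoc, h1]
  choose k hk using hH
  have hj' (h : H) (t : ℕ) (u : quo a t ⟶ H) (hu : u (1 : A ⧸ a ^ t) = h) :
      j t u = j (k h) (quoDesc a h (hk h)) := by
    rw [← hj t (max t (k h)) (le_max_left _ _), ← hj (k h) (max t (k h)) (le_max_right _ _)]
    congr 1
    apply quo_hom_ext
    rw [ModuleCat.comp_apply, ModuleCat.comp_apply, quoMap_one, quoMap_one, hu, quoDesc_one]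
  have hex (h : H) (t : ℕ) (ht : k h ≤ t) : ∃ u : quo a t ⟶ H, u (1 : A ⧸ a ^ t) = h :=
    ⟨quoMap a ht ≫ quoDesc a h (hk h), by
      rw [ModuleCat.comp_apply, quoMap_one, quoDesc_one]⟩
  let E : H →ₗ[A] (localCohomology a c).obj M :=
    { toFun h := j (k h) (quoDesc a h (hk h))
      map_add' h h' := by
        obtain ⟨u, hu⟩ := hex h (max (k h) (k h')) (le_max_left _ _)
        obtain ⟨u', hu'⟩ := hex h' (max (k h) (k h')) (le_max_right _ _)
        rw [← hj' _ _ u hu, ← hj' _ _ u' hu',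
          ← hj' (h + h') _ (u + u') (congrArg₂ (· + ·) hu hu')]
        simp only [j, Functor.map_add, Preadditive.add_comp, map_add]
      map_smul' r h := by
        obtain ⟨u, hu⟩ := hex h (k h) le_rfl
        rw [← hj' _ _ u hu, ← hj' (r • h) _ (r • u) (congrArg (r • ·) hu)]
        simp only [j, Functor.map_smul, Linear.smul_comp, map_smul, RingHom.id_apply] }
  refine ⟨LinearEquiv.ofBijective E ⟨?_, fun y => ?_⟩⟩
  · rw [← LinearMap.ker_eq_bot, LinearMap.ker_eq_bot']
    intro h hh
    obtain ⟨s, hs, h0⟩ := h3 _ _ hh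
    rw [← Category.assoc, ← Functor.map_comp] at h0
    have h4 := (singleFunctor (ModuleCat.{0} A) (c : ℤ)).map_injective
      (((hφ.postcomp c _ (quo_isPowTorsion a s)).1 (h0.trans zero_comp.symm)).trans
        (Functor.map_zero _ _ _).symm)
    have h5 := ConcreteCategory.congr_hom h4 (1 : A ⧸ a ^ s)
    rw [ModuleCat.comp_apply, quoMap_one, quoDesc_one] at h5
    exact h5
  · obtain ⟨t, x, rfl⟩ := h2 y
    obtain ⟨v, rfl⟩ := (hφ.postcomp c _ (quo_isPowTorsion a t)).2 x
    obtain ⟨u, rfl⟩ := (singleFunctor (ModuleCat.{0} A) (c : ℤ)).map_surjective v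
    exact ⟨u (1 : A ⧸ a ^ t), (hj' _ t u rfl).symm⟩

end LocalCohomology

section Endomorphisms

open Limits Triangulated Pretriangulated

open DerivedCategory

variable {A : Type} [CommRing A]

lemma isPowTorsion_of_span [IsNoetherianRing A] {a : Ideal A} {s : Set A}
    (hs : Ideal.span s = a) (H : ModuleCat.{0} A)
    (h : ∀ y ∈ s, ∀ z : H, ∃ k : ℕ, y ^ k • z = 0) : IsPowTorsion a H := by
  intro z
  have hle : a ≤ Ideal.radical (LinearMap.ker (LinearMap.toSpanSingleton A H z)) := by
    rw [← hs, Ideal.span_le]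
    intro y hy
    obtain ⟨k, hk⟩ := h y hy z
    exact ⟨k, hk⟩
  obtain ⟨n, hn⟩ := Ideal.exists_pow_le_of_le_radical_of_fg hle (IsNoetherian.noetherian a)
  exact ⟨n, fun r hr => hn hr⟩

lemma toModuleEnd_bijective_of_linearEquiv {M N : Type} [AddCommGroup M] [Module A M]
    [AddCommGroup N] [Module A N] (e : M ≃ₗ[A] N)
    (h : Function.Bijective (Module.toModuleEnd A (M := M) (S := A))) :
    Function.Bijective (Module.toModuleEnd A (M := N) (S := A)) := by
  have := e.conj.bijective.comp h
  convert! this using 1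
  ext r z
  simp

variable [HasDerivedCategory (ModuleCat.{0} A)]

lemma IsTorsionApprox.of_iso (a : Ideal A) {F S : DerivedCategory (ModuleCat.{0} A)} (e : F ≅ S) :
    IsTorsionApprox a e.hom where
  precomp _ := ⟨fun _ _ h => (cancel_epi e.hom).1 h,
    fun f => ⟨e.inv ≫ f, e.hom_inv_id_assoc f⟩⟩
  postcomp _ _ _ := ⟨fun _ _ h => (cancel_mono e.hom).1 h,
    fun f => ⟨f ≫ e.inv, by simp⟩⟩

/-- If a single module is a torsion approximation of the ring, then its endomorphisms are the
homotheties. -/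
lemma toModuleEnd_bijective_of_isTorsionApprox {a : Ideal A} {c : ℤ} {H : ModuleCat.{0} A}
    (hH : IsPowTorsion a H) (φ : (singleFunctor (ModuleCat.{0} A) c).obj H ⟶
      (singleFunctor (ModuleCat.{0} A) 0).obj (ModuleCat.of A A)) (hφ : IsTorsionApprox a φ) :
    Function.Bijective (Module.toModuleEnd A (M := H) (S := A)) := by
  have key (r : A) : (singleFunctor (ModuleCat.{0} A) c).map (r • 𝟙 H) ≫ φ =
      φ ≫ (singleFunctor (ModuleCat.{0} A) 0).map (r • 𝟙 (ModuleCat.of A A)) := by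
    rw [Functor.map_smul, Functor.map_smul, Linear.smul_comp, Linear.comp_smul,
      CategoryTheory.Functor.map_id, CategoryTheory.Functor.map_id, Category.id_comp,
      Category.comp_id]
  refine ⟨fun r r' h => ?_, fun f => ?_⟩
  · have h1 : r • 𝟙 H = r' • 𝟙 H := by
      ext z
      exact LinearMap.congr_fun h z
    have h2 := key r
    rw [h1, key r'] at h2
    have h3 := (singleFunctor (ModuleCat.{0} A) 0).map_injective ((hφ.precomp 0).1 h2)
    have h4 := ConcreteCategory.congr_hom h3 (1 : A)
    have h5 : r' • (1 : A) = r • (1 : A) := h4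
    simpa using h5.symm
  · obtain ⟨g, hg⟩ := (hφ.precomp 0).2 ((singleFunctor (ModuleCat.{0} A) c).map
      (ModuleCat.ofHom f) ≫ φ)
    obtain ⟨g, rfl⟩ := (singleFunctor (ModuleCat.{0} A) 0).map_surjective g
    have hr : g = (g (1 : A) : A) • 𝟙 (ModuleCat.of A A) := by
      apply ModuleCat.hom_ext
      apply LinearMap.ext_ring
      exact (mul_one (g (1 : A) : A)).symm
    refine ⟨(g (1 : A) : A), ?_⟩
    have h1 : (singleFunctor (ModuleCat.{0} A) c).map ((g (1 : A) : A) • 𝟙 H) =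
        (singleFunctor (ModuleCat.{0} A) c).map (ModuleCat.ofHom f) := by
      apply (hφ.postcomp c H hH).1
      refine (key _).trans ?_
      rw [← hr]
      exact hg
    have h2 := (singleFunctor (ModuleCat.{0} A) c).map_injective h1
    ext z
    exact ConcreteCategory.congr_hom h2 z

lemma ne_top_of_nontrivial_localCohomology {a : Ideal A} {c : ℕ} {M : ModuleCat.{0} A}
    (hnon : Nontrivial ((localCohomology a c).obj M)) : a ≠ ⊤ := by
  rintro rfl
  obtain ⟨ι, -, hι, -⟩ := exists_localCohomology_hom_maps (⊤ : Ideal A) c M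
  obtain ⟨y, hy⟩ := exists_ne (0 : (localCohomology (⊤ : Ideal A) c).obj M)
  obtain ⟨t, x, rfl⟩ := hι y
  have hz : 𝟙 (quo (⊤ : Ideal A) t) = 0 := by
    apply quo_hom_ext
    obtain ⟨k, hk⟩ := quo_isPowTorsion (⊤ : Ideal A) t (1 : A ⧸ (⊤ : Ideal A) ^ t)
    exact (one_smul A _).symm.trans (hk 1 (by rw [Ideal.top_pow]; trivial))
  apply hy
  rw [← Category.id_comp x, ← CategoryTheory.Functor.map_id, hz, Functor.map_zero, zero_comp,
    map_zero]

lemma exists_isTorsionApprox_single [IsNoetherianRing A] [IsLocalRing A]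
    [IsAdicComplete (IsLocalRing.maximalIdeal A) A] {a : Ideal A} {c : ℕ}
    (hvan : ∀ i : ℕ, i ≠ c → Subsingleton ((localCohomology a i).obj (ModuleCat.of A A)))
    (ha : a ≤ IsLocalRing.maximalIdeal A) :
    ∃ (H : ModuleCat.{0} A) (φ : (singleFunctor (ModuleCat.{0} A) c).obj H ⟶
      (singleFunctor (ModuleCat.{0} A) 0).obj (ModuleCat.of A A)),
      IsPowTorsion a H ∧ IsTorsionApprox a φ := by
  obtain ⟨s, hs⟩ := IsNoetherian.noetherian a
  have hsa (y) (hy : y ∈ s) : y ∈ a := hs ▸ Ideal.subset_span hy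
  obtain ⟨F, φ, hφ, hF, ⟨q, hq⟩, ht⟩ := exists_isTorsionApprox (a := a)
    (IsLocalRing.maximalIdeal A) s
    ((singleFunctor (ModuleCat.{0} A) 0).obj (ModuleCat.of A A)) 0 0
    (fun y hy => ⟨ha (hsa y hy), hsa y hy⟩)
  obtain ⟨H, u, hH⟩ := exists_iso_single_of_isTorsionApprox φ hφ 0 q
    (fun j => isPowTorsion_of_span (s := (s : Set A)) hs _ fun y hy z => ht y hy j z) c
    (fun p hp t v => by
      rcases lt_or_ge p 0 with h0 | h0
      · exact ⟨t, le_rfl, by rw [TStructure.t.zero v p 0 h0, comp_zero]⟩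
      · lift p to ℕ using h0
        have := hvan p (by exact_mod_cast hp)
        obtain ⟨ι, -, -, h⟩ := exists_localCohomology_hom_maps a p (ModuleCat.of A A)
        exact h t v (Subsingleton.elim _ _))
  exact ⟨H, u.hom ≫ φ, hH, (IsTorsionApprox.of_iso a u).comp hφ⟩

end Endomorphisms

end HellusStuckrad

/-- **Hellus–Stückrad.** Let `(A, 𝔪)` be a complete Noetherian local ring and `𝔞` an ideal such
that `H^i_𝔞(A) = 0` for all `i ≠ c` and `H^c_𝔞(A) ≠ 0`.  Then the natural ring homomorphism
`A → End_A(H^c_𝔞(A))` sending `a` to multiplication by `a` is an isomorphism (bijective); in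
particular no nonzero element of `A` annihilates `H^c_𝔞(A)`. -/
theorem hellus_stuckrad_endomorphisms
    (A : Type) [CommRing A] [IsNoetherianRing A] [IsLocalRing A]
    [IsAdicComplete (IsLocalRing.maximalIdeal A) A]
    (a : Ideal A) (c : ℕ)
    (hvan : ∀ i : ℕ, i ≠ c → Subsingleton ((localCohomology a i).obj (ModuleCat.of A A)))
    (hnon : Nontrivial ((localCohomology a c).obj (ModuleCat.of A A))) :
    Function.Bijective
        (Module.toModuleEnd A (M := (localCohomology a c).obj (ModuleCat.of A A)) (S := A)) ∧
      Module.annihilator A ((localCohomology a c).obj (ModuleCat.of A A)) = ⊥ := by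
  let := HasDerivedCategory.standard (ModuleCat.{0} A)
  obtain ⟨H, φ, hH, hφ⟩ := HellusStuckrad.exists_isTorsionApprox_single hvan
    (IsLocalRing.le_maximalIdeal (HellusStuckrad.ne_top_of_nontrivial_localCohomology hnon))
  obtain ⟨e⟩ := HellusStuckrad.nonempty_linearEquiv_localCohomology a c _ H hH φ hφ
  have h := HellusStuckrad.toModuleEnd_bijective_of_linearEquiv e
    (HellusStuckrad.toModuleEnd_bijective_of_isTorsionApprox hH φ hφ)
  refine ⟨h, (Submodule.eq_bot_iff _).2 fun r hr => h.1 ?_⟩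
  rw [map_zero]
  exact LinearMap.ext fun z => Module.mem_annihilator.1 hr z
end

section
/- (Lyubeznik) Let (R,m,k) be a commutative Noetherian regular local ring containing a field, let n = dim R, let I be a proper ideal of R, and let d = dim(R/I). Then the highest Lyubeznik number is positive: Ext^d_R(k, H^{n−d}_I(R)) ≠ 0. -/
open CategoryTheory

/-! ### `Ext` as a derived functor and `Abelian.Ext` -/

namespace CategoryTheory.ProjectiveResolution

open Abelian HomologicalComplex

universe v

variable {C : Type*} [Category.{v} C] [Abelian C] {R : Type v} [CommRing R] [Linear R C]

section restriction

variable (R) {X X' : C} (Y : C) {P : ProjectiveResolution X} {P' : ProjectiveResolution X'}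
  {f : X ⟶ X'}

/-- The map of cochain complexes `Hom(L, Y) ⟶ Hom(K, Y)` induced by a chain map `K ⟶ L`. -/
noncomputable def mapLinearYonedaObj {K L : ChainComplex C ℕ} (φ : K ⟶ L) :
    L.linearYonedaObj R Y ⟶ K.linearYonedaObj R Y :=
  (unopFunctor _ _).map
    ((((linearYoneda R C).obj Y).rightOp.mapHomologicalComplex _).map φ).op

lemma map_isoExt_hom [EnoughProjectives C] (φ : Hom P P' f) (n : ℕ) :
    ((_root_.Ext R C n).map f.op).app Y ≫ (P.isoExt n Y).hom =
      (P'.isoExt n Y).hom ≫ homologyMap (mapLinearYonedaObj R Y φ.hom) n := by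
  have h1 := P.isoLeftDerivedObj_inv_naturality f P' φ.hom
    (by simpa using φ.hom_f_zero_comp_π_f_zero) ((linearYoneda R C).obj Y).rightOp n
  have h2 := (homologyOpNatIso (ModuleCat R) (ComplexShape.up ℕ) n).inv.naturality
    (mapLinearYonedaObj R Y φ.hom).op
  have h1' := congrArg Quiver.Hom.unop h1
  have h2' := congrArg Quiver.Hom.unop h2
  refine (Category.assoc _ _ _).symm.trans ?_
  refine (congrArg (· ≫ (HomologicalComplex.homologyUnop _ _).inv) h1').trans ?_
  refine (Category.assoc _ _ _).trans ?_
  refine Eq.trans ?_ (Category.assoc _ _ _).symm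
  exact congrArg (_ ≫ ·) h2'.symm

variable (P) in
lemma d_comp_iCycles (n : ℕ) (z : (P.complex.linearYonedaObj R Y).cycles n) :
    P.complex.d (n + 1) n ≫ ((P.complex.linearYonedaObj R Y).iCycles n z : P.complex.X n ⟶ Y) = 0 :=
  ConcreteCategory.congr_hom ((P.complex.linearYonedaObj R Y).iCycles_d n (n + 1)) z

end restriction

variable [HasExt.{v} C]

lemma smul_extMk {X Y : C} (P : ProjectiveResolution X) {n : ℕ} (r : R) (f : P.complex.X n ⟶ Y)
    (m : ℕ) (hm : n + 1 = m) (hf : P.complex.d m n ≫ f = 0) :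
    P.extMk (r • f) m hm (by simp [hf]) = r • P.extMk f m hm hf := by
  rw [Ext.smul_eq_comp_mk₀, extMk_comp_mk₀]
  congr 1
  simp

lemma extMk_degree_zero_eq_zero {X Y : C} (P : ProjectiveResolution X) (f : P.complex.X 0 ⟶ Y)
    (hf : P.complex.d 1 0 ≫ f = 0) (h : P.extMk f 1 rfl hf = 0) : f = 0 := by
  rw [← P.extEquivCohomologyClass.apply_eq_iff_eq,
    extEquivCohomologyClass_extMk, extEquivCohomologyClass_zero,
    CochainComplex.HomComplex.CohomologyClass.mk_eq_zero_iff,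
    CochainComplex.HomComplex.Cocycle.toSingleMk_mem_coboundaries_iff _ _ _ _ _ 1 (by simp)] at h
  obtain ⟨g, hg⟩ := h
  have hz : Limits.IsZero (P.cochainComplex.X 1) :=
    CochainComplex.isZero_of_isStrictlyLE P.cochainComplex 0 1 (by simp)
  rw [← cancel_epi (P.cochainComplexXIso (-((0:ℕ):ℤ)) 0 rfl).hom, ← hg, hz.eq_of_src g 0]
  simp

section comparison

variable (R) {X Y : C} (P : ProjectiveResolution X) (n : ℕ)

local notation "Kc" => ChainComplex.linearYonedaObj (ProjectiveResolution.complex P) R Y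

variable (Y) in
/-- The map sending a cocycle `P.complex.X n ⟶ Y` to the extension class it represents. -/
noncomputable def cyclesToExt : (Kc).cycles n ⟶ ModuleCat.of R (Ext X Y n) :=
  ModuleCat.ofHom
  { toFun z := P.extMk ((Kc).iCycles n z) (n + 1) rfl (P.d_comp_iCycles R Y n z)
    map_add' a b := by
      refine Eq.trans ?_ (P.add_extMk _ _ _ _ _ _).symm
      congr 1
      exact map_add ((Kc).iCycles n).hom a b
    map_smul' r a := by
      refine Eq.trans ?_ (P.smul_extMk r _ _ _ _)
      congr 1
      exact map_smul ((Kc).iCycles n).hom r a }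

lemma cyclesToExt_apply (z : (Kc).cycles n) :
    P.cyclesToExt R Y n z =
      P.extMk ((Kc).iCycles n z) (n + 1) rfl (P.d_comp_iCycles R Y n z) := rfl

lemma cyclesToExt_eq_zero_iff (z : (Kc).cycles n) :
    P.cyclesToExt R Y n z = 0 ↔ (Kc).homologyπ n z = 0 := by
  have hinj : Function.Injective ((Kc).iCycles n) :=
    (ModuleCat.mono_iff_injective _).1 inferInstance
  obtain ⟨j, hj⟩ : ∃ j, (ComplexShape.up ℕ).prev n = j := ⟨_, rfl⟩
  have hex := (ShortComplex.moduleCat_exact_iff _).1 (ShortComplex.exact_of_g_is_cokernel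
    (.mk ((Kc).toCycles j n) ((Kc).homologyπ n) (by simp)) ((Kc).homologyIsCokernel j n hj))
  constructor
  · intro h
    rw [cyclesToExt_apply] at h
    obtain _ | p := n
    · have h0 : (Kc).iCycles 0 z = 0 := P.extMk_degree_zero_eq_zero _ _ h
      rw [hinj (h0.trans (map_zero _).symm), map_zero]
    · obtain ⟨g, hg⟩ := (P.extMk_eq_zero_iff _ _ _ _ p rfl).1 h
      have : z = (Kc).toCycles p (p + 1) g := by
        apply hinj
        rw [← hg]
        exact (ConcreteCategory.congr_hom ((Kc).toCycles_i p (p + 1)) g).symm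
      rw [this]
      exact ConcreteCategory.congr_hom ((Kc).toCycles_comp_homologyπ p (p + 1)) g
  · intro h
    obtain ⟨g, rfl⟩ := hex z h
    change P.cyclesToExt R Y n ((Kc).toCycles j n g) = 0
    have e : (Kc).iCycles n ((Kc).toCycles j n g) = (Kc).d j n g :=
      ConcreteCategory.congr_hom ((Kc).toCycles_i _ n) g
    rw [cyclesToExt_apply]
    obtain _ | p := n
    · have e' : (Kc).iCycles 0 ((Kc).toCycles j 0 g) = 0 := by
        rw [e, (Kc).shape _ _ (by simp)]; rfl
      simp only [e']
      exact P.extMk_zero _ rfl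
    · obtain rfl : p = j := by simpa using hj
      exact (P.extMk_eq_zero_iff _ _ _ _ _ rfl).2 ⟨g, e.symm⟩

lemma cyclesToExt_surjective : Function.Surjective (P.cyclesToExt R Y n) := by
  intro α
  obtain ⟨f, hf, rfl⟩ := P.extMk_surjective α (n + 1) rfl
  have hex := (ShortComplex.moduleCat_exact_iff _).1 (ShortComplex.exact_of_f_is_kernel
    (.mk ((Kc).iCycles n) ((Kc).d n (n + 1)) ((Kc).iCycles_d n (n + 1)))
    ((Kc).cyclesIsKernel n (n + 1) (by simp)))
  obtain ⟨z, hz⟩ := hex f hf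
  refine ⟨z, ?_⟩
  rw [cyclesToExt_apply]
  congr 1

variable (Y) in
/-- The comparison from cohomology computed with a projective resolution to `Abelian.Ext`. -/
noncomputable def homologyToExt : (Kc).homology n ⟶ ModuleCat.of R (Ext X Y n) :=
  ((Kc).homologyIsCokernel ((ComplexShape.up ℕ).prev n) n rfl).desc
    (Limits.CokernelCofork.ofπ (P.cyclesToExt R Y n) (by
      ext g
      exact (P.cyclesToExt_eq_zero_iff R n _).2
        (ConcreteCategory.congr_hom ((Kc).toCycles_comp_homologyπ _ n) g)))

lemma homologyπ_homologyToExt :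
    (Kc).homologyπ n ≫ P.homologyToExt R Y n = P.cyclesToExt R Y n :=
  ((Kc).homologyIsCokernel ((ComplexShape.up ℕ).prev n) n rfl).fac _
    Limits.WalkingParallelPair.one

lemma homologyToExt_bijective : Function.Bijective (P.homologyToExt R Y n) := by
  have h := ConcreteCategory.congr_hom (P.homologyπ_homologyToExt R (Y := Y) n)
  constructor
  · refine (injective_iff_map_eq_zero (P.homologyToExt R Y n).hom).2 fun w hw ↦ ?_
    obtain ⟨z, rfl⟩ := (ModuleCat.epi_iff_surjective ((Kc).homologyπ n)).1 inferInstance w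
    exact (P.cyclesToExt_eq_zero_iff R n z).1 ((h z).symm.trans hw)
  · intro α
    obtain ⟨z, rfl⟩ := P.cyclesToExt_surjective R n α
    exact ⟨_, h z⟩

instance : IsIso (P.homologyToExt R Y n) :=
  (ConcreteCategory.isIso_iff_bijective _).2 (P.homologyToExt_bijective R n)

end comparison

section naturality

variable (R) {X X' : C} (Y : C) {P : ProjectiveResolution X} {P' : ProjectiveResolution X'}
  {f : X ⟶ X'}

/-- Precomposition with a morphism `f` on `Ext`, as a morphism of `R`-modules. -/
noncomputable def precompExt (f : X ⟶ X') (n : ℕ) :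
    ModuleCat.of R (Ext X' Y n) ⟶ ModuleCat.of R (Ext X Y n) :=
  ModuleCat.ofHom
    { toFun α := (Ext.mk₀ f).comp α (zero_add n)
      map_add' := by simp
      map_smul' := by simp }

lemma homologyMap_homologyToExt (φ : Hom P P' f) (n : ℕ) :
    homologyMap (mapLinearYonedaObj R Y φ.hom) n ≫ P.homologyToExt R Y n =
      P'.homologyToExt R Y n ≫ precompExt R Y f n := by
  rw [← cancel_epi ((P'.complex.linearYonedaObj R Y).homologyπ n),
    homologyπ_naturality_assoc, homologyπ_homologyToExt,
    reassoc_of% (P'.homologyπ_homologyToExt R n)]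
  ext z
  refine Eq.trans ?_ (mk₀_comp_extMk _ (n + 1) rfl (P'.d_comp_iCycles R Y n z) φ).symm
  change P.cyclesToExt R Y n (cyclesMap (mapLinearYonedaObj R Y φ.hom) n z) = _
  rw [cyclesToExt_apply]
  congr 1
  exact ConcreteCategory.congr_hom (cyclesMap_i (mapLinearYonedaObj R Y φ.hom) n) z

variable [EnoughProjectives C]

variable (X) in
/-- `Ext` as a derived functor agrees with `Abelian.Ext`. -/
noncomputable def extIso (n : ℕ) :
    ((_root_.Ext R C n).obj (Opposite.op X)).obj Y ≅ ModuleCat.of R (Ext X Y n) :=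
  (projectiveResolution X).isoExt n Y ≪≫ asIso ((projectiveResolution X).homologyToExt R Y n)

variable (f) in
lemma map_extIso_hom (n : ℕ) :
    ((_root_.Ext R C n).map f.op).app Y ≫ (extIso R X Y n).hom =
      (extIso R X' Y n).hom ≫ precompExt R Y f n := by
  let φ : Hom (projectiveResolution X) (projectiveResolution X') f :=
    { hom := lift f _ _
      hom_f_zero_comp_π_f_zero :=
        HomologicalComplex.congr_hom
          (lift_commutes f (projectiveResolution X) (projectiveResolution X')) 0 }
  simp only [extIso, Iso.trans_hom, asIso_hom, Category.assoc]
  rw [reassoc_of% (map_isoExt_hom R Y φ n), homologyMap_homologyToExt]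

end naturality

end CategoryTheory.ProjectiveResolution

/-! ### Regular local rings -/

namespace IsLocalRing

universe u

lemma exists_mem_span_insert_erase {R : Type*} [CommRing R] [IsLocalRing R] [DecidableEq R]
    {s : Finset R} (hs : Ideal.span (s : Set R) = maximalIdeal R) {x : R}
    (hx : x ∈ maximalIdeal R) (hx2 : x ∉ maximalIdeal R ^ 2) :
    ∃ i ∈ s, Ideal.span (insert x (s.erase i : Set R)) = maximalIdeal R := by
  obtain ⟨a, -, ha⟩ := Submodule.mem_span_finset.1 (hs ▸ hx : x ∈ Ideal.span (s : Set R))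
  have hsm : ∀ i ∈ s, i ∈ maximalIdeal R := fun i hi ↦ hs ▸ Ideal.subset_span hi
  obtain ⟨i, hi, hu⟩ : ∃ i ∈ s, IsUnit (a i) := by
    by_contra! hc
    refine hx2 (ha ▸ sum_mem fun i hi ↦ ?_)
    rw [pow_two]
    exact Ideal.mul_mem_mul (hc i hi) (hsm i hi)
  refine ⟨i, hi, le_antisymm (Ideal.span_le.2 ?_) ?_⟩
  · rintro y (rfl | hy)
    exacts [hx, hsm y (Finset.mem_of_mem_erase hy)]
  · rw [← hs, Ideal.span_le]
    intro y hy
    obtain rfl | hne := eq_or_ne y i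
    · obtain ⟨b, hb⟩ := hu.exists_left_inv
      have : y = b * (x - ∑ j ∈ s.erase y, a j • j) := by
        rw [← ha, ← Finset.add_sum_erase s _ hi]
        simp [← mul_assoc, hb]
      refine Set.mem_of_eq_of_mem this ?_
      exact Ideal.mul_mem_left _ _ (sub_mem (Ideal.subset_span (Set.mem_insert _ _))
        (sum_mem fun j hj ↦ Ideal.mul_mem_left _ _
          (Ideal.subset_span (Set.mem_insert_of_mem _ hj))))
    · exact Ideal.subset_span (Set.mem_insert_of_mem _ (by simp_all))

lemma exists_notMem_pow_two_of_one_le_ringKrullDim {R : Type*} [CommRing R] [IsLocalRing R]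
    [IsNoetherianRing R] (h : 1 ≤ ringKrullDim R) :
    ∃ x ∈ maximalIdeal R, x ∉ maximalIdeal R ^ 2 ∧ ∀ P ∈ minimalPrimes R, x ∉ P := by
  by_contra! hc
  have hfin := minimalPrimes.finite_of_isNoetherianRing R
  classical
  have hsub : (maximalIdeal R : Set R) ⊆
      ⋃ i ∈ ((insert (maximalIdeal R ^ 2) hfin.toFinset : Finset (Ideal R)) : Set (Ideal R)),
        ((id i : Ideal R) : Set R) := by
    intro x hx
    by_cases hx2 : x ∈ maximalIdeal R ^ 2
    · exact Set.mem_biUnion (x := maximalIdeal R ^ 2) (by simp) hx2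
    · obtain ⟨P, hP, hxP⟩ := hc x hx hx2
      exact Set.mem_biUnion (x := P) (by simp [hP]) hxP
  obtain ⟨P, hP, hle⟩ := (Ideal.subset_union_prime (maximalIdeal R ^ 2) (maximalIdeal R ^ 2) (by
    intro P hP h1 _
    rw [Finset.mem_insert, hfin.mem_toFinset] at hP
    exact (hP.resolve_left h1).1.1)).1 hsub
  rw [Finset.mem_insert] at hP
  have hdim : ∀ P ∈ minimalPrimes R, ¬ maximalIdeal R ≤ P := by
    intro P hP hle
    have := hP.1.1
    have hPm : P = maximalIdeal R := le_antisymm (le_maximalIdeal this.ne_top) hle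
    rw [← maximalIdeal_height_eq_ringKrullDim, ← hPm, Ideal.height_eq_zero_iff.2 hP] at h
    exact absurd h (by decide)
  obtain rfl | hP := hP
  · have : maximalIdeal R = ⊥ := by
      refine Submodule.eq_bot_of_le_smul_of_le_jacobson_bot (maximalIdeal R) _
        (IsNoetherian.noetherian _) ?_ (maximalIdeal_le_jacobson _)
      simpa [pow_two] using hle
    obtain ⟨P, hP, -⟩ := Ideal.exists_minimalPrimes_le (bot_le : ⊥ ≤ maximalIdeal R)
    exact hdim P hP (this ▸ bot_le)
  · exact hdim P (by simpa using hP) hle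

/-- A regular local ring is a domain. -/
theorem isDomain_of_card_le_ringKrullDim (k : ℕ) (R : Type u) [CommRing R] [IsLocalRing R]
    [IsNoetherianRing R] (s : Finset R) (hs : Ideal.span (s : Set R) = maximalIdeal R)
    (hsk : s.card ≤ k) (hk : k ≤ ringKrullDim R) : IsDomain R := by
  classical
  induction k generalizing R with
  | zero =>
    obtain rfl : s = ∅ := by simpa using hsk
    have : IsField R := isField_iff_maximalIdeal_eq.2 (by simpa using hs.symm)
    exact this.isDomain
  | succ k ih =>
    obtain ⟨x, hx, hx2, hxP⟩ := exists_notMem_pow_two_of_one_le_ringKrullDim (R := R)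
      (le_trans (by norm_cast; lia) hk)
    obtain ⟨i, hi, hspan⟩ := exists_mem_span_insert_erase hs hx hx2
    have hne : Ideal.span {x} ≠ ⊤ := by
      intro h
      rw [Ideal.span_singleton_eq_top] at h
      exact hx h
    have : Nontrivial (R ⧸ Ideal.span {x}) := Ideal.Quotient.nontrivial_iff.2 hne
    have : IsLocalRing (R ⧸ Ideal.span {x}) :=
      .of_surjective' (Ideal.Quotient.mk _) Ideal.Quotient.mk_surjective
    have hdom : IsDomain (R ⧸ Ideal.span {x}) := by
      refine ih _ ((s.erase i).image (Ideal.Quotient.mk _)) ?_ ?_ ?_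
      · rw [← map_maximalIdeal_of_surjective (Ideal.Quotient.mk (Ideal.span {x}))
          Ideal.Quotient.mk_surjective, ← hspan, Ideal.map_span, Set.image_insert_eq,
          Ideal.Quotient.eq_zero_iff_mem.2 (Ideal.mem_span_singleton_self x),
          Ideal.span_insert_zero]
        simp
      · refine Finset.card_image_le.trans ?_
        rw [Finset.card_erase_of_mem hi]
        lia
      · have := ringKrullDim_le_ringKrullDim_quotient_add_card {x}
          (by simpa [IsLocalRing.ringJacobson_eq_maximalIdeal] using hx)
        have := hk.trans this
        rw [Finset.card_singleton, Finset.coe_singleton] at this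
        push_cast at this
        exact ENat.WithBot.add_le_add_one_right_iff.1 this
    have hprime : (Ideal.span {x}).IsPrime := (Ideal.Quotient.isDomain_iff_prime _).1 hdom
    obtain ⟨P, hP, hle⟩ := Ideal.exists_minimalPrimes_le (bot_le : ⊥ ≤ Ideal.span {x})
    have hPp := hP.1.1
    have : P = ⊥ := by
      refine Submodule.eq_bot_of_le_smul_of_le_jacobson_bot (maximalIdeal R) _
        (IsNoetherian.noetherian _) ?_ (maximalIdeal_le_jacobson _)
      intro p hp
      obtain ⟨r, rfl⟩ := Ideal.mem_span_singleton'.1 (hle hp)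
      rw [mul_comm]
      exact Submodule.smul_mem_smul hx ((hPp.mem_or_mem hp).resolve_right (hxP P hP))
    subst this
    exact IsDomain.of_bot_isPrime R

/-- A list of `dim R` generators of the maximal ideal is a regular sequence. -/
theorem isWeaklyRegular_of_ofList_eq_maximalIdeal {R : Type u} [CommRing R] [IsLocalRing R]
    [IsNoetherianRing R] (xs : List R) (hs : Ideal.ofList xs = maximalIdeal R)
    (hd : xs.length ≤ ringKrullDim R) : RingTheory.Sequence.IsWeaklyRegular R xs := by
  classical
  rw [RingTheory.Sequence.isWeaklyRegular_iff]
  intro i hi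
  have hmem : ∀ x ∈ xs, x ∈ maximalIdeal R := fun x hx ↦ hs ▸ Ideal.subset_span hx
  set J := Ideal.ofList (xs.take i) with hJ
  have hJle : J ≤ maximalIdeal R :=
    Ideal.span_le.2 fun x hx ↦ hmem x (List.mem_of_mem_take hx)
  have hdrop : J ⊔ Ideal.ofList (xs.drop i) = maximalIdeal R := by
    rw [← Ideal.ofList_append, List.take_append_drop, hs]
  have hcard : ∀ l : List R, (∀ x ∈ l, x ∈ maximalIdeal R) →
      ringKrullDim R ≤ ringKrullDim (R ⧸ Ideal.ofList l) + l.length := by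
    intro l hl
    have := ringKrullDim_le_ringKrullDim_quotient_add_card l.toFinset (by
      intro x hx
      rw [IsLocalRing.ringJacobson_eq_maximalIdeal]
      exact hl x (by simpa using hx))
    rw [List.coe_toFinset] at this
    refine this.trans (add_le_add_right ?_ _)
    exact_mod_cast l.toFinset_card_le
  have hne : J ≠ ⊤ := fun h ↦ (maximalIdeal.isMaximal R).ne_top (top_le_iff.1 (h ▸ hJle))
  have : Nontrivial (R ⧸ J) := Ideal.Quotient.nontrivial_iff.2 hne
  have : IsLocalRing (R ⧸ J) :=
    .of_surjective' (Ideal.Quotient.mk _) Ideal.Quotient.mk_surjective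
  have hdom : IsDomain (R ⧸ J) := by
    refine isDomain_of_card_le_ringKrullDim (xs.length - i) (R ⧸ J)
      ((xs.drop i).toFinset.image (Ideal.Quotient.mk _)) ?_ ?_ ?_
    · rw [← map_maximalIdeal_of_surjective (Ideal.Quotient.mk J)
        Ideal.Quotient.mk_surjective, ← hdrop, Ideal.map_sup, Ideal.map_quotient_self,
        bot_sup_eq, Ideal.map_span]
      simp
    · exact Finset.card_image_le.trans ((List.toFinset_card_le _).trans (by simp))
    · have := hd.trans (hcard (xs.take i) fun x hx ↦ hmem x (List.mem_of_mem_take hx))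
      rw [List.length_take, min_eq_left hi.le,
        show (xs.length : WithBot ℕ∞) = (xs.length - i : ℕ) + (i : ℕ) by
          rw [← Nat.cast_add, Nat.sub_add_cancel hi.le]] at this
      exact ENat.WithBot.add_le_add_natCast_right_iff.1 this
  have hxJ : xs[i] ∉ J := by
    intro hx
    have hJ' : Ideal.ofList (xs.take i ++ xs.drop (i + 1)) = maximalIdeal R := by
      rw [Ideal.ofList_append, ← hdrop, List.drop_eq_getElem_cons hi, Ideal.ofList_cons,
        ← sup_assoc, sup_eq_left.2 ((Ideal.span_singleton_le_iff_mem _).2 hx)]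
    have := hcard (xs.take i ++ xs.drop (i + 1)) fun x hx ↦ by
      rw [List.mem_append] at hx
      exact hmem x (hx.elim List.mem_of_mem_take List.mem_of_mem_drop)
    rw [hJ', ringKrullDim_eq_zero_of_isField
      ((Ideal.Quotient.maximal_ideal_iff_isField_quotient _).1 (maximalIdeal.isMaximal R)),
      zero_add] at this
    have := hd.trans this
    simp only [List.length_append, List.length_take, List.length_drop] at this
    norm_cast at this
    lia
  have hreg : IsSMulRegular (R ⧸ J) xs[i] := by
    intro a b hab
    have h0 : Ideal.Quotient.mk J xs[i] ≠ 0 := by rwa [Ne, Ideal.Quotient.eq_zero_iff_mem]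
    simp only [Algebra.smul_def] at hab
    exact mul_left_cancel₀ h0 hab
  have e : (J • ⊤ : Ideal R) = J := by simp
  rw [e]
  exact hreg

end IsLocalRing

/-! ### Vanishing of `Ext` and regular sequences -/

namespace ModuleCat

open Abelian RingTheory.Sequence Pointwise

universe u

variable {R : Type u} [CommRing R]

lemma smul_quotient_eq_zero {I : Ideal R} {a : R} (ha : a ∈ I) (l : of R (R ⧸ I)) : a • l = 0 := by
  rw [Algebra.smul_def]
  exact (congrArg (· * l) (Ideal.Quotient.eq_zero_iff_mem.2 ha)).trans (zero_mul _)

lemma quotient_hom_eq_zero {I : Ideal R} {N : ModuleCat.{u} R} {f : of R (R ⧸ I) ⟶ N}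
    (hf : f.hom (1 : R ⧸ I) = 0) : f = 0 := by
  refine hom_ext (LinearMap.ext fun a ↦ ?_)
  obtain ⟨r, rfl⟩ := Ideal.Quotient.mk_surjective a
  have hr : (Ideal.Quotient.mk I r : R ⧸ I) = r • (1 : R ⧸ I) := by
    rw [Algebra.smul_def, mul_one]; rfl
  rw [hr]
  exact (map_smul f.hom r (1 : R ⧸ I)).trans (by rw [hf, smul_zero]; rfl)

lemma smul_ext_eq_zero {L Y : ModuleCat.{u} R} {a : R} (h : ∀ l : L, a • l = 0) {i : ℕ}
    (α : Ext L Y i) : a • α = 0 := by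
  have h0 : a • 𝟙 L = 0 := by
    ext l
    exact h l
  rw [← Ext.mk₀_id_comp α, ← Ext.smul_comp, ← Ext.mk₀_smul, h0]
  simp

/-- A regular element on `Y` acts injectively on `Ext i L Y` if `Ext j L (Y / x Y)` vanishes for
all `j < i`. -/
lemma ext_eq_zero_of_smul_eq_zero {L Y : ModuleCat.{u} R} {x : R} (hx : IsSMulRegular Y x) {i : ℕ}
    (h : ∀ j < i, Subsingleton (Ext L (of R (QuotSMulTop x Y)) j)) (α : Ext L Y i)
    (hα : x • α = 0) : α = 0 := by
  rw [Ext.smul_eq_comp_mk₀] at hα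
  have hS := hx.smulShortComplex_shortExact
  obtain _ | i := i
  · have := hS.mono_f
    exact Ext.postcomp_mk₀_injective_of_mono L (Y.smulShortComplex x).f (hα.trans (map_zero _).symm)
  · obtain ⟨β, rfl⟩ := Ext.covariant_sequence_exact₁ L hS α hα rfl
    have : Subsingleton (Ext L (Y.smulShortComplex x).X₃ i) := h i (by lia)
    rw [Subsingleton.elim β 0]
    exact Ext.zero_comp L i hS.extClass (i + 1) rfl

lemma subsingleton_ext_of_isWeaklyRegular (L : ModuleCat.{u} R) (xs : List R)
    (hL : ∀ x ∈ xs, ∃ k : ℕ, ∀ l : L, x ^ k • l = 0) (Y : ModuleCat.{u} R)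
    (hY : IsWeaklyRegular Y xs) (i : ℕ) (hi : i < xs.length) : Subsingleton (Ext L Y i) := by
  induction xs generalizing Y i with
  | nil => simp at hi
  | cons x xs ih =>
    rw [isWeaklyRegular_cons_iff] at hY
    obtain ⟨k, hk⟩ := hL x (by simp)
    refine subsingleton_of_forall_eq 0 fun α ↦ ?_
    have key : ∀ β : Ext L Y i, x • β = 0 → β = 0 :=
      ext_eq_zero_of_smul_eq_zero hY.1 fun j hj ↦
        ih (fun y hy ↦ hL y (by simp [hy])) (of R (QuotSMulTop x Y)) hY.2 j (by simp at hi; lia)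
    have hα : x ^ k • α = 0 := smul_ext_eq_zero hk α
    clear hk
    induction k with
    | zero => simpa using hα
    | succ k ihk => exact ihk (key _ (by rw [smul_smul, ← pow_succ', hα]))

lemma subsingleton_ext_of_bijective {L Y : ModuleCat.{u} R} {x : R}
    (hL : ∃ k : ℕ, ∀ l : L, x ^ k • l = 0) (hY : Function.Bijective (fun y : Y ↦ x • y)) (i : ℕ) :
    Subsingleton (Ext L Y i) := by
  obtain ⟨k, hk⟩ := hL
  have hb : Function.Bijective (fun y : Y ↦ x ^ k • y) := by
    convert hY.iterate k using 1
    ext y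
    exact (smul_iterate_apply x k y).symm
  have : IsIso (x ^ k • 𝟙 Y) := (ConcreteCategory.isIso_iff_bijective _).2 hb
  refine subsingleton_of_forall_eq 0 fun α ↦ ?_
  have := smul_ext_eq_zero hk α
  rw [Ext.smul_eq_comp_mk₀] at this
  have h2 := congrArg (fun β ↦ β.comp (Ext.mk₀ (inv (x ^ k • 𝟙 Y))) (add_zero i)) this
  simpa using h2

lemma subsingleton_ext_quotSMulTop {K M : ModuleCat.{u} R} {x : R} (hx : IsSMulRegular M x) {t : ℕ}
    (h : ∀ i < t + 1, Subsingleton (Ext K M i)) :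
    ∀ i < t, Subsingleton (Ext K (of R (QuotSMulTop x M)) i) := by
  intro i hi
  have : Subsingleton (Ext K (M.smulShortComplex x).X₁ (i + 1)) := h (i + 1) (by lia)
  have : Subsingleton (Ext K (M.smulShortComplex x).X₂ i) := h i (by lia)
  refine subsingleton_of_forall_eq 0 fun α ↦ ?_
  obtain ⟨β, rfl⟩ := Ext.covariant_sequence_exact₃ K hx.smulShortComplex_shortExact α rfl
    (Subsingleton.elim _ _)
  rw [show β = 0 from this.elim _ _]
  exact Ext.zero_comp K i _ _ _

lemma exists_isSMulRegular_of_subsingleton_ext [IsNoetherianRing R] {I : Ideal R}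
    (M : ModuleCat.{u} R) [Module.Finite R M] (h : Subsingleton (Ext (of R (R ⧸ I)) M 0)) :
    ∃ x ∈ I, IsSMulRegular M x := by
  have : Subsingleton (of R (R ⧸ I) ⟶ M) := Ext.addEquiv₀.subsingleton_congr.mp h
  have : Subsingleton ((R ⧸ I) →ₗ[R] M) :=
    (ModuleCat.homAddEquiv (M := of R (R ⧸ I)) (N := M)).symm.subsingleton
  obtain ⟨x, hx, hx'⟩ := IsSMulRegular.subsingleton_linearMap_iff.mp this
  exact ⟨x, by rwa [Ideal.annihilator_quotient] at hx, hx'⟩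

lemma ringKrullDim_quotient_add_one_le {P Q : Ideal R} [P.IsPrime] (hPQ : P ≤ Q) {y : R}
    (hyQ : y ∈ Q) (hyP : y ∉ P) : ringKrullDim (R ⧸ Q) + 1 ≤ ringKrullDim (R ⧸ P) := by
  have hy0 : Ideal.Quotient.mk P y ≠ 0 := by rwa [Ne, Ideal.Quotient.eq_zero_iff_mem]
  refine le_trans ?_ (ringKrullDim_quotient_succ_le_of_nonZeroDivisor
    (mem_nonZeroDivisors_of_ne_zero hy0))
  gcongr
  let f : (R ⧸ P) ⧸ Ideal.span {Ideal.Quotient.mk P y} →+* R ⧸ Q :=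
    Ideal.Quotient.lift _ (Ideal.Quotient.factor hPQ) (fun a ha ↦ by
      obtain ⟨b, rfl⟩ := Ideal.mem_span_singleton'.1 ha
      rw [map_mul, Ideal.Quotient.factor_mk, Ideal.Quotient.eq_zero_iff_mem.2 hyQ, mul_zero])
  refine ringKrullDim_le_of_surjective f ?_
  intro b
  obtain ⟨a, rfl⟩ := Ideal.Quotient.mk_surjective b
  exact ⟨Ideal.Quotient.mk _ (Ideal.Quotient.mk P a), by simp [f]⟩

/-- If `P` annihilates a nonzero element of `M`, then some associated prime of `M / y M`
contains `P` and `y`. -/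
lemma exists_isAssociatedPrime_quotSMulTop [IsNoetherianRing R] [IsLocalRing R] {M : Type u}
    [AddCommGroup M] [Module R M] [Module.Finite R M] {P : Ideal R} {y : R}
    (hy : y ∈ IsLocalRing.maximalIdeal R) (hreg : IsSMulRegular M y)
    {h : M} (h0 : h ≠ 0) (hP : ∀ p ∈ P, p • h = 0) :
    ∃ Q, IsAssociatedPrime Q (QuotSMulTop y M) ∧ P ≤ Q ∧ y ∈ Q := by
  let H : Submodule R M := Submodule.torsionBySet R M P
  have hH : ∃ g ∈ H, g ∉ y • (⊤ : Submodule R M) := by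
    by_contra! hc
    have hle : H ≤ IsLocalRing.maximalIdeal R • H := by
      intro g hg
      obtain ⟨g', -, rfl⟩ := Submodule.mem_smul_pointwise_iff_exists _ _ _ |>.1 (hc g hg)
      refine Submodule.smul_mem_smul hy ?_
      rw [Submodule.mem_torsionBySet_iff] at hg ⊢
      intro a
      have := hg a
      rw [smul_comm] at this
      exact hreg (this.trans (smul_zero y).symm)
    have : H = ⊥ := Submodule.eq_bot_of_le_smul_of_le_jacobson_bot _ _ (IsNoetherian.noetherian H)
      hle (IsLocalRing.maximalIdeal_le_jacobson _)
    refine h0 ((Submodule.mem_bot R).1 (this ▸ ?_))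
    exact (Submodule.mem_torsionBySet_iff _ _).2 fun a ↦ hP a a.2
  obtain ⟨g, hg, hgy⟩ := hH
  have hne : Submodule.mkQ (y • (⊤ : Submodule R M)) g ≠ 0 := by simpa using hgy
  obtain ⟨Q, hQ, hle⟩ := exists_le_isAssociatedPrime_of_isNoetherianRing R _ hne
  refine ⟨Q, hQ, fun p hp ↦ hle ?_, hle ?_⟩
  · rw [Submodule.mem_colon_singleton, ← map_smul,
      (Submodule.mem_torsionBySet_iff _ _).1 hg ⟨p, hp⟩]
    simp
  · rw [Submodule.mem_colon_singleton, ← map_smul, Submodule.mem_bot]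
    simp only [Submodule.mkQ_apply, Submodule.Quotient.mk_eq_zero]
    exact Submodule.smul_mem_pointwise_smul _ _ _ trivial

/-- The depth of a module is at most the dimension of `R ⧸ P` for each associated prime `P`. -/
lemma le_ringKrullDim_quotient_of_isAssociatedPrime [IsNoetherianRing R] [IsLocalRing R] (t : ℕ)
    (M : ModuleCat.{u} R) [Module.Finite R M]
    (h : ∀ i < t, Subsingleton (Ext (of R (R ⧸ IsLocalRing.maximalIdeal R)) M i))
    (P : Ideal R) (hP : IsAssociatedPrime P M) : t ≤ ringKrullDim (R ⧸ P) := by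
  induction t generalizing M P with
  | zero =>
    have := hP.isPrime
    exact_mod_cast ringKrullDim_nonneg_of_nontrivial
  | succ t ih =>
    obtain ⟨y, hy, hreg⟩ := exists_isSMulRegular_of_subsingleton_ext M (h 0 (by lia))
    have hP' := hP.isPrime
    obtain ⟨-, g, hg⟩ := isAssociatedPrime_iff.1 hP
    have hPg : ∀ p, p ∈ P → p • g = 0 := fun p hp ↦ by
      rw [hg, Submodule.mem_colon_singleton] at hp
      exact (Submodule.mem_bot R).1 hp
    have hg0 : g ≠ 0 := by
      rintro rfl
      refine hP'.ne_top (hg.trans (Ideal.eq_top_iff_one _ |>.2 ?_))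
      rw [Submodule.mem_colon_singleton, smul_zero]
      exact zero_mem _
    obtain ⟨Q, hQ, hPQ, hyQ⟩ := exists_isAssociatedPrime_quotSMulTop hy hreg hg0 hPg
    have hyP : y ∉ P := fun hyP ↦ hg0 (hreg ((hPg y hyP).trans (smul_zero y).symm))
    have := ih (of R (QuotSMulTop y M)) (subsingleton_ext_quotSMulTop hreg h) Q hQ
    push_cast
    exact le_trans (add_le_add_left this 1) (ringKrullDim_quotient_add_one_le hPQ hyQ hyP)

/-- The depth of a module is at most the sum of `dim (R ⧸ I)` and the grade of `I`. -/
lemma le_ringKrullDim_quotient_add [IsNoetherianRing R] [IsLocalRing R] (I : Ideal R) (l : ℕ)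
    (t : ℕ) (M : ModuleCat.{u} R) [Module.Finite R M]
    (hI : ∀ i < l, Subsingleton (Ext (of R (R ⧸ I)) M i)) (hl : Nontrivial (Ext (of R (R ⧸ I)) M l))
    (h : ∀ i < t, Subsingleton (Ext (of R (R ⧸ IsLocalRing.maximalIdeal R)) M i)) :
    t ≤ ringKrullDim (R ⧸ I) + l := by
  induction l generalizing M t with
  | zero =>
    have : Nontrivial (of R (R ⧸ I) ⟶ M) := Ext.addEquiv₀.nontrivial_congr.mp hl
    obtain ⟨f, hf⟩ := exists_ne (0 : of R (R ⧸ I) ⟶ M)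
    have h1 : f.hom (1 : R ⧸ I) ≠ 0 := fun h1 ↦ hf (quotient_hom_eq_zero h1)
    obtain ⟨Q, hQ, hle⟩ := exists_le_isAssociatedPrime_of_isNoetherianRing R _ h1
    have hIQ : I ≤ Q := fun a ha ↦ hle <| by
      rw [Submodule.mem_colon_singleton, ← map_smul]
      have : a • (1 : R ⧸ I) = 0 := smul_quotient_eq_zero ha _
      rw [this, map_zero]
      exact zero_mem _
    refine (le_ringKrullDim_quotient_of_isAssociatedPrime t M h Q hQ).trans ?_
    simpa using ringKrullDim_le_of_surjective _ (Ideal.Quotient.factor_surjective hIQ)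
  | succ l ih =>
    obtain _ | t := t
    · have hne : Nontrivial (R ⧸ I) := by
        by_contra hc
        rw [not_nontrivial_iff_subsingleton] at hc
        refine not_subsingleton_iff_nontrivial.2 hl (subsingleton_of_forall_eq 0 fun α ↦ ?_)
        rw [← one_smul R α]
        exact smul_ext_eq_zero (fun a ↦ hc.elim _ _) α
      exact_mod_cast add_nonneg ringKrullDim_nonneg_of_nontrivial (Nat.cast_nonneg (l + 1))
    obtain ⟨x, hx, hreg⟩ := exists_isSMulRegular_of_subsingleton_ext M (hI 0 (by lia))
    have hI' := subsingleton_ext_quotSMulTop hreg hI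
    have hl' : Nontrivial (Ext (of R (R ⧸ I)) (of R (QuotSMulTop x M)) l) := by
      by_contra hc
      rw [not_nontrivial_iff_subsingleton] at hc
      refine not_subsingleton_iff_nontrivial.2 hl (subsingleton_of_forall_eq 0 fun α ↦ ?_)
      refine ext_eq_zero_of_smul_eq_zero hreg (fun j hj ↦ ?_) α
        (smul_ext_eq_zero (smul_quotient_eq_zero hx) α)
      obtain hj | rfl := (Nat.lt_succ_iff_lt_or_eq).1 hj
      exacts [hI' j hj, hc]
    have := ih t (of R (QuotSMulTop x M)) hI' hl' (subsingleton_ext_quotSMulTop hreg h)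
    push_cast
    rw [← add_assoc]
    exact add_le_add_left this 1

/-! ### Classes representing `Ext` on torsion modules -/

lemma extClass_comp_bijective {S : ShortComplex (ModuleCat.{u} R)} (hS : S.ShortExact)
    {L : ModuleCat.{u} R} (h : ∀ i, Subsingleton (Ext L S.X₂ i)) (i j : ℕ) (hij : i + 1 = j) :
    Function.Bijective (fun α : Ext L S.X₃ i ↦ α.comp hS.extClass hij) := by
  constructor
  · refine (injective_iff_map_eq_zero (hS.extClass.postcomp L hij)).2 fun α hα ↦ ?_
    obtain ⟨γ, rfl⟩ := Ext.covariant_sequence_exact₃ L hS α hij hα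
    rw [Subsingleton.elim γ 0, Ext.zero_comp]
  · intro α
    exact Ext.covariant_sequence_exact₁ L hS α (Subsingleton.elim _ _) hij

lemma smul_bijective_localizedModule (N : Type u) [AddCommGroup N] [Module R N] (x : R) :
    Function.Bijective (fun y : LocalizedModule (Submonoid.powers x) N ↦ x • y) :=
  (Module.End.isUnit_iff _).1 (IsLocalizedModule.map_units
    (LocalizedModule.mkLinearMap (Submonoid.powers x) N) ⟨x, Submonoid.mem_powers x⟩)

/-- The sequence `N → N[1/x] → N[1/x] / N`. -/
noncomputable abbrev localizationShortComplex (N : ModuleCat.{u} R) (x : R) :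
    ShortComplex (ModuleCat.{u} R) :=
  ShortComplex.mk (ofHom (LocalizedModule.mkLinearMap (Submonoid.powers x) N))
    (ofHom (LocalizedModule.mkLinearMap (Submonoid.powers x) N).range.mkQ) (by
      ext v
      exact (Submodule.Quotient.mk_eq_zero _).2 ⟨v, rfl⟩)

lemma localizationShortComplex_shortExact (N : ModuleCat.{u} R) {x : R} (hx : IsSMulRegular N x) :
    (localizationShortComplex N x).ShortExact := by
  refine ShortComplex.ShortExact.mk' ?_ ?_ ?_
  · rw [ShortComplex.moduleCat_exact_iff]
    intro v hv
    exact (Submodule.Quotient.mk_eq_zero _).1 hv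
  · rw [ModuleCat.mono_iff_injective]
    refine (injective_iff_map_eq_zero (LocalizedModule.mkLinearMap (Submonoid.powers x) N)).2
      fun v hv ↦ ?_
    obtain ⟨⟨_, k, rfl⟩, hc⟩ := (IsLocalizedModule.eq_zero_iff (Submonoid.powers x) _).1 hv
    exact (hx.pow k) (Eq.trans hc (smul_zero _).symm)
  · rw [ModuleCat.epi_iff_surjective]
    exact Submodule.mkQ_surjective _

lemma exists_pow_smul_localizationShortComplex (N : ModuleCat.{u} R) (x : R)
    (v : (localizationShortComplex N x).X₃) : ∃ k : ℕ, x ^ k • v = 0 := by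
  obtain ⟨w, rfl⟩ := Submodule.mkQ_surjective _ v
  obtain ⟨⟨n, ⟨_, k, rfl⟩⟩, hn⟩ :=
    IsLocalizedModule.surj (Submonoid.powers x)
      (LocalizedModule.mkLinearMap (Submonoid.powers x) N) w
  refine ⟨k, ?_⟩
  rw [← map_smul]
  exact (Submodule.Quotient.mk_eq_zero _).2 ⟨n, hn.symm⟩

lemma smul_localizationShortComplex (N : ModuleCat.{u} R) (x : R) (y : R)
    (hN : ∀ v : N, ∃ k : ℕ, y ^ k • v = 0)
    (v : (localizationShortComplex N x).X₃) : ∃ k : ℕ, y ^ k • v = 0 := by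
  obtain ⟨w, rfl⟩ := Submodule.mkQ_surjective _ v
  induction w using LocalizedModule.induction_on with
  | h n s =>
    obtain ⟨k, hk⟩ := hN n
    refine ⟨k, ?_⟩
    rw [← map_smul, LocalizedModule.smul'_mk, hk, LocalizedModule.zero_mk, map_zero]

/-- For a regular sequence `xs` of length `c` on `Y`, there is a class `τ : Ext N Y c` composition
with which identifies `Ext L N i` with `Ext L Y (i + c)` for all modules `L` killed by powers
of `xs`. -/
theorem exists_ext_comp_bijective (Y : ModuleCat.{u} R) (xs : List R) (hY : IsWeaklyRegular Y xs)
    (c : ℕ) (hc : xs.length = c) :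
    ∃ (N : ModuleCat.{u} R) (τ : Ext N Y c), (∀ x ∈ xs, ∀ v : N, ∃ k : ℕ, x ^ k • v = 0) ∧
      ∀ L : ModuleCat.{u} R, (∀ x ∈ xs, ∃ k : ℕ, ∀ l : L, x ^ k • l = 0) →
        ∀ (i j : ℕ) (h : i + c = j), Function.Bijective (fun α : Ext L N i ↦ α.comp τ h) := by
  induction xs using List.reverseRecOn generalizing c with
  | nil =>
    subst hc
    refine ⟨Y, Ext.mk₀ (𝟙 Y), fun _ h ↦ absurd h List.not_mem_nil, fun L _ i j h ↦ ?_⟩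
    obtain rfl : i = j := by simpa using h
    simpa using! Function.bijective_id
  | append_singleton xs x ih =>
    obtain ⟨N, τ, hN, hb⟩ := ih ((isWeaklyRegular_append_iff _ _ _).1 hY).1 _ rfl
    have hx : IsSMulRegular N x := by
      rw [isSMulRegular_iff_right_eq_zero_of_smul]
      intro v hv
      let L : ModuleCat.{u} R := of R (Submodule.span R {v})
      have hspan : ∀ a : R, a • v = 0 → ∀ l : L, a • l = 0 := by
        rintro a ha ⟨l, hl⟩
        obtain ⟨b, rfl⟩ := Submodule.mem_span_singleton.1 hl
        ext
        change a • b • v = 0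
        rw [smul_comm, ha, smul_zero]
      have hL : ∀ y ∈ xs ++ [x], ∃ k : ℕ, ∀ l : L, y ^ k • l = 0 := by
        intro y hy
        obtain hy | rfl : y ∈ xs ∨ y = x := by simpa using hy
        · obtain ⟨k, hk⟩ := hN y hy v
          exact ⟨k, hspan _ hk⟩
        · exact ⟨1, hspan _ (by rwa [pow_one])⟩
      have hs := subsingleton_ext_of_isWeaklyRegular L _ hL Y hY xs.length (by simp)
      have h0 : Ext.mk₀ (ofHom (Submodule.span R {v}).subtype) = (0 : Ext L N 0) :=
        (hb L (fun y hy ↦ hL y (by simp [hy])) 0 _ (zero_add _)).1 (Subsingleton.elim _ _)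
      rw [Ext.mk₀_eq_zero_iff] at h0
      exact ConcreteCategory.congr_hom h0 (⟨v, Submodule.mem_span_singleton_self v⟩ : L)
    have hS := localizationShortComplex_shortExact N hx
    refine ⟨(localizationShortComplex N x).X₃,
      hS.extClass.comp τ (by simp [← hc, add_comm]), ?_, ?_⟩
    · intro y hy v
      obtain hy | rfl : y ∈ xs ∨ y = x := by simpa using hy
      · exact smul_localizationShortComplex N x y (hN y hy) v
      · exact exists_pow_smul_localizationShortComplex N y v
    · intro L hL i j h
      have h1 := extClass_comp_bijective hS (L := L) (fun i ↦ subsingleton_ext_of_bijective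
        (hL x (by simp)) (smul_bijective_localizedModule N x) i) i (i + 1) rfl
      have h2 := hb L (fun y hy ↦ hL y (by simp [hy])) (i + 1) j (by simp at hc; lia)
      convert h2.comp h1 using 1
      ext α
      exact (Ext.comp_assoc α hS.extClass τ _ _ (by simp at hc; lia)).symm

/-! ### Cohen–Macaulay local rings -/

lemma subsingleton_ext_residue_of_regular [IsNoetherianRing R] [IsLocalRing R]
    (s : Finset R) (hs : Ideal.span (s : Set R) = IsLocalRing.maximalIdeal R)
    (hd : (s.card : WithBot ℕ∞) = ringKrullDim R) (i : ℕ) (hi : i < s.card) :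
    Subsingleton (Ext (of R (R ⧸ IsLocalRing.maximalIdeal R)) (of R R) i) := by
  have hl : Ideal.ofList s.toList = IsLocalRing.maximalIdeal R := by
    rw [← hs]
    refine congrArg _ (Set.ext fun x ↦ ?_)
    simp
  refine subsingleton_ext_of_isWeaklyRegular _ s.toList (fun x hx ↦ ⟨1, fun l ↦ ?_⟩) _
    (IsLocalRing.isWeaklyRegular_of_ofList_eq_maximalIdeal s.toList hl (by simp [hd])) i (by simpa)
  have hx : x ∈ IsLocalRing.maximalIdeal R := hl ▸ Ideal.subset_span hx
  rw [pow_one, smul_quotient_eq_zero hx]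

/-- The grade of an ideal in a Cohen–Macaulay local ring is its codimension. -/
theorem exists_isRegular_of_cohenMacaulay [IsNoetherianRing R] [IsLocalRing R] {n d : ℕ}
    (hn : (n : WithBot ℕ∞) = ringKrullDim R)
    (hR : ∀ i < n, Subsingleton (Ext (of R (R ⧸ IsLocalRing.maximalIdeal R)) (of R R) i))
    {I : Ideal R} (hI : I ≠ ⊤) (hd : (d : WithBot ℕ∞) = ringKrullDim (R ⧸ I)) :
    ∃ xs : List R, xs.length + d = n ∧ (∀ x ∈ xs, x ∈ I) ∧ IsRegular R xs ∧
      Nontrivial (Ext (of R (R ⧸ I)) (of R R) xs.length) := by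
  have hlt : I • (⊤ : Submodule R (of R R)) < ⊤ := by
    rw [lt_top_iff_ne_top]
    have : I • (⊤ : Submodule R R) = I := by simp
    exact fun h ↦ hI (this ▸ h)
  have rees : ∀ c : ℕ, (∀ i < c, Subsingleton (Ext (of R (R ⧸ I)) (of R R) i)) →
      ∃ rs : List R, rs.length = c ∧ (∀ r ∈ rs, r ∈ I) ∧ IsRegular R rs := fun c h ↦
    exists_isRegular_of_exists_subsingleton_ext I c (of R R) hlt (of R (R ⧸ I))
      (Module.support_eq_zeroLocus.trans
        (congrArg (fun J : Ideal R ↦ PrimeSpectrum.zeroLocus (J : Set R))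
          Ideal.annihilator_quotient)) h
  have dimle : ∀ rs : List R, (∀ r ∈ rs, r ∈ I) → IsRegular R rs → d + rs.length ≤ n := by
    intro rs hrs hreg
    have h1 := ringKrullDim_add_length_eq_ringKrullDim_of_isRegular rs hreg
    have h2 := ringKrullDim_le_of_surjective _
      (Ideal.Quotient.factor_surjective (Ideal.span_le.2 hrs : Ideal.ofList rs ≤ I))
    rw [← hd] at h2
    rw [← hn] at h1
    have := (add_le_add_left h2 (rs.length : WithBot ℕ∞)).trans h1.le
    exact_mod_cast this
  have hex : ∃ l, Nontrivial (Ext (of R (R ⧸ I)) (of R R) l) := by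
    by_contra! hc
    obtain ⟨rs, hlen, hrs, hreg⟩ := rees (n + 1) fun i _ ↦ hc i
    have := dimle rs hrs hreg
    lia
  classical
  have hmin : ∀ i < Nat.find hex, Subsingleton (Ext (of R (R ⧸ I)) (of R R) i) := fun i hi ↦
    not_nontrivial_iff_subsingleton.1 (Nat.find_min hex hi)
  obtain ⟨rs, hlen, hrs, hreg⟩ := rees _ hmin
  have h1 := dimle rs hrs hreg
  have h2 := le_ringKrullDim_quotient_add I (Nat.find hex) n (of R R) hmin (Nat.find_spec hex) hR
  rw [← hd] at h2
  norm_cast at h2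
  exact ⟨rs, by lia, hrs, hreg, hlen ▸ Nat.find_spec hex⟩

/-! ### Nonvanishing of `Ext` from the residue field -/

lemma exists_pow_smul_ne [IsNoetherianRing R] [IsLocalRing R] {M : Type*} [AddCommGroup M]
    [Module R M] [Module.Finite R M] {y : R} (hy : y ∈ IsLocalRing.maximalIdeal R) {g : M}
    (hg : g ≠ 0) : ∃ s : ℕ, ∀ g' : M, y ^ s • g' ≠ g := by
  by_contra! hc
  have := Ideal.iInf_pow_smul_eq_bot_of_isLocalRing (M := M) (IsLocalRing.maximalIdeal R)
    (IsLocalRing.maximalIdeal.isMaximal R).ne_top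
  refine hg ((Submodule.mem_bot R).1 (this ▸ (Submodule.mem_iInf _).2 fun s ↦ ?_))
  obtain ⟨g', rfl⟩ := hc s
  exact Submodule.smul_mem_smul (Ideal.pow_mem_pow hy s) trivial

/-- Nonzero extension classes are detected by composing with classes from modules of finite
length. -/
theorem exists_ext_comp_ne_zero [IsNoetherianRing R] [IsLocalRing R] {Y : ModuleCat.{u} R}
    [Module.Finite R Y] (d : ℕ) (W : ModuleCat.{u} R) [Module.Finite R W]
    (hW : ∀ i < d, Subsingleton (Ext (of R (R ⧸ IsLocalRing.maximalIdeal R)) W i))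
    (hd : Module.supportDim R W ≤ d) (c : ℕ) (g : Ext W Y c) (hg : g ≠ 0) :
    ∃ (L : ModuleCat.{u} R) (_ : Module.Finite R L) (_ : Module.supportDim R L ≤ 0)
      (ε : Ext L W d), ∀ (j : ℕ) (h : d + c = j), ε.comp g h ≠ 0 := by
  induction d generalizing W c with
  | zero =>
    refine ⟨W, inferInstance, hd, Ext.mk₀ (𝟙 W), fun j h h0 ↦ hg ?_⟩
    obtain rfl : c = j := by lia
    exact (Ext.mk₀_id_comp g).symm.trans h0
  | succ d ih =>
    obtain ⟨y, hy, hreg⟩ := exists_isSMulRegular_of_subsingleton_ext W (hW 0 (by lia))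
    obtain ⟨s, hs⟩ := exists_pow_smul_ne hy hg
    have hs0 : s ≠ 0 := by
      rintro rfl
      exact hs g (by rw [pow_zero, one_smul])
    have hregs := hreg.pow s
    have hys := Ideal.pow_mem_of_mem _ hy s (Nat.pos_of_ne_zero hs0)
    set x := y ^ s
    have hS := hregs.smulShortComplex_shortExact
    have hdim : Module.supportDim R (QuotSMulTop x W) ≤ d := by
      have := Module.supportDim_quotSMulTop_succ_eq_supportDim hregs hys
      rw [← this] at hd
      push_cast at hd
      exact ENat.WithBot.add_le_add_one_right_iff.1 hd
    have hg' : hS.extClass.comp g (add_comm 1 c) ≠ 0 := by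
      intro h0
      obtain ⟨g', hg'⟩ := Ext.contravariant_sequence_exact₁ hS Y g (add_comm 1 c) h0
      have key (g' : Ext W Y c) : x • g' = (Ext.mk₀ (x • 𝟙 W)).comp g' (zero_add c) := by
        rw [Ext.mk₀_smul, Ext.smul_comp, Ext.mk₀_id_comp]
      exact hs g' ((key g').trans hg')
    obtain ⟨L, hL, hLd, ε, hε⟩ := ih (of R (QuotSMulTop x W))
      (subsingleton_ext_quotSMulTop hregs hW) hdim (c + 1) _ hg'
    refine ⟨L, hL, hLd, ε.comp hS.extClass rfl, fun j h h0 ↦ hε j (by lia) ?_⟩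
    rw [← h0]
    exact (Ext.comp_assoc _ _ _ _ _ (by lia)).symm

lemma asIdeal_eq_maximalIdeal_of_supportDim_le_zero [IsLocalRing R] {L : Type*} [AddCommGroup L]
    [Module R L] (hL : Module.supportDim R L ≤ 0) (p : PrimeSpectrum R)
    (hp : p ∈ Module.support R L) : p.asIdeal = IsLocalRing.maximalIdeal R := by
  have hle : p ≤ IsLocalRing.closedPoint R := IsLocalRing.le_maximalIdeal p.2.ne_top
  have hm := Order.krullDim_nonpos_iff_forall_isMax.1 hL ⟨p, hp⟩
  have := @hm ⟨_, Module.mem_support_mono hle hp⟩ hle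
  exact congrArg PrimeSpectrum.asIdeal (le_antisymm hle this)

/-- If `Ext d` vanishes on the residue field, it vanishes on all modules of finite length. -/
theorem subsingleton_ext_of_supportDim_le_zero [IsNoetherianRing R] [IsLocalRing R]
    {M : ModuleCat.{u} R} {d : ℕ}
    (h : Subsingleton (Ext (of R (R ⧸ IsLocalRing.maximalIdeal R)) M d))
    (L : ModuleCat.{u} R) [hfin : Module.Finite R L] (hL : Module.supportDim R L ≤ 0) :
    Subsingleton (Ext L M d) := by
  have hL' := asIdeal_eq_maximalIdeal_of_supportDim_le_zero hL
  revert hL'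
  change _ → Subsingleton (Ext (of R L) M d)
  refine IsNoetherianRing.induction_on_isQuotientEquivQuotientPrime R hfin
    (motive := fun N _ _ _ ↦ (∀ p ∈ Module.support R N, p.asIdeal = IsLocalRing.maximalIdeal R) →
      Subsingleton (Ext (of R N) M d)) ?_ ?_ ?_
  · intro N _ _ _ _ _
    refine subsingleton_of_forall_eq 0 fun α ↦ ?_
    rw [← Ext.mk₀_id_comp α, (isZero_of_subsingleton (of R N)).eq_of_src (𝟙 _) 0]
    simp
  · intro N _ _ _ p e hN
    have hp : p.asIdeal = IsLocalRing.maximalIdeal R := by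
      refine hN p ?_
      rw [e.support_eq, Module.support_eq_zeroLocus, Ideal.annihilator_quotient]
      exact le_refl p.asIdeal
    let i : of R N ≅ of R (R ⧸ IsLocalRing.maximalIdeal R) :=
      (e.trans (Submodule.quotEquivOfEq _ _ hp)).toModuleIso
    refine subsingleton_of_forall_eq 0 fun α ↦ ?_
    rw [← Ext.mk₀_id_comp α, ← i.hom_inv_id, ← Ext.mk₀_comp_mk₀_assoc,
      Subsingleton.elim ((Ext.mk₀ i.inv).comp α _) 0, Ext.comp_zero]
  · intro N₁ _ _ _ N₂ _ _ _ N₃ _ _ _ f g hf hg hfg h₁ h₃ hN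
    have := h₁ fun p hp ↦ hN p (Module.support_subset_of_injective f hf hp)
    have := h₃ fun p hp ↦ hN p (Module.support_subset_of_surjective g hg hp)
    let S : ShortComplex (ModuleCat.{u} R) := .mk (ofHom f) (ofHom g)
      (hom_ext hfg.linearMap_comp_eq_zero)
    have hS : S.ShortExact :=
      { exact := (ShortComplex.ShortExact.moduleCat_exact_iff_function_exact S).2 hfg
        mono_f := (mono_iff_injective _).2 hf
        epi_g := (epi_iff_surjective _).2 hg }
    refine subsingleton_of_forall_eq 0 fun α ↦ ?_
    obtain ⟨β, rfl⟩ := Ext.contravariant_sequence_exact₂ hS M α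
      (Subsingleton.elim (α := Ext (of R N₁) M d) _ _)
    rw [Subsingleton.elim (α := Ext (of R N₃) M d) β 0]
    exact Ext.comp_zero _ _ _ _ _

lemma subsingleton_ext_of_iso {K M M' : ModuleCat.{u} R} (e : M ≅ M') {i : ℕ}
    (h : Subsingleton (Ext K M i)) : Subsingleton (Ext K M' i) := by
  refine subsingleton_of_forall_eq 0 fun α ↦ ?_
  rw [← Ext.comp_mk₀_id α, ← e.inv_hom_id, ← Ext.mk₀_comp_mk₀, ← Ext.comp_assoc_of_third_deg_zero,
    Subsingleton.elim (α.comp (Ext.mk₀ e.inv) _) 0, Ext.zero_comp]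

lemma subsingleton_ext_quotient_ofList {K : ModuleCat.{u} R} (xs : List R) (M : ModuleCat.{u} R)
    (hM : IsWeaklyRegular M xs) {t : ℕ} (h : ∀ i < t + xs.length, Subsingleton (Ext K M i)) :
    ∀ i < t, Subsingleton (Ext K (of R (M ⧸ (Ideal.ofList xs • ⊤ : Submodule R M))) i) := by
  induction xs generalizing M with
  | nil =>
    intro i hi
    exact subsingleton_ext_of_iso
      (Submodule.quotEquivOfEqBot _ (by simp)).symm.toModuleIso (h i hi)
  | cons x xs ih =>
    intro i hi
    rw [isWeaklyRegular_cons_iff] at hM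
    exact subsingleton_ext_of_iso
      (Submodule.quotOfListConsSMulTopEquivQuotSMulTopInner M x xs).symm.toModuleIso
      (ih (of R (QuotSMulTop x M)) hM.2 (subsingleton_ext_quotSMulTop hM.1 h) i hi)

/-- If a map from `M` to the module `N` representing `Ext` on torsion modules is nonzero on an
element killed by the regular sequence `xs`, then `Ext d` from the residue field to `M` is
nonzero. -/
theorem nontrivial_ext_residue [IsNoetherianRing R] [IsLocalRing R] {d : ℕ} {xs : List R}
    (hxs : IsRegular R xs) (hd : (d + xs.length : ℕ) = ringKrullDim R)
    (hR : ∀ i < d + xs.length,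
      Subsingleton (Ext (of R (R ⧸ IsLocalRing.maximalIdeal R)) (of R R) i))
    {M N : ModuleCat.{u} R} {τ : Ext N (of R R) xs.length}
    (hτ : ∀ L : ModuleCat.{u} R, (∀ x ∈ xs, ∃ k, ∀ l : L, x ^ k • l = 0) →
      ∀ i j (h : i + xs.length = j), Function.Bijective (fun α : Ext L N i ↦ α.comp τ h))
    (φ : M ⟶ N) (m : M) (hm : ∀ x ∈ xs, x • m = 0) (hφ : φ.hom m ≠ 0) :
    Nontrivial (Ext (of R (R ⧸ IsLocalRing.maximalIdeal R)) M d) := by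
  let J : Ideal R := Ideal.ofList xs • ⊤
  have hJ : J = Ideal.ofList xs := by simp [J]
  let W : ModuleCat R := of R (R ⧸ J)
  have hWdim : Module.supportDim R W ≤ d := by
    have := Module.supportDim_add_length_eq_supportDim_of_isRegular (M := R) xs hxs
    rw [Module.supportDim_self_eq_ringKrullDim, ← hd, Nat.cast_add,
      ENat.WithBot.add_natCast_cancel] at this
    exact this.le
  have hW := subsingleton_ext_quotient_ofList xs (of R R) hxs.toIsWeaklyRegular hR
  have hJm : J ≤ LinearMap.ker (LinearMap.toSpanSingleton R M m) := by
    rw [hJ]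
    exact Ideal.span_le.2 hm
  let f : W ⟶ M := ofHom (Submodule.liftQ J (LinearMap.toSpanSingleton R M m) hJm)
  have hf : f ≫ φ ≠ 0 := by
    intro h
    refine hφ ?_
    have h1 := congrArg (fun q : W ⟶ N ↦ q.hom (Submodule.Quotient.mk 1)) h
    have h2 : f.hom (Submodule.Quotient.mk 1) = m := one_smul R m
    exact (congrArg φ.hom h2).symm.trans h1
  have hW' : ∀ x ∈ xs, ∃ k, ∀ l : W, x ^ k • l = 0 := fun x hx ↦ ⟨1, fun l ↦ by
    have hxJ : x ∈ J := hJ ▸ Ideal.subset_span hx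
    rw [pow_one]
    exact smul_quotient_eq_zero hxJ l⟩
  have hg : (Ext.mk₀ (f ≫ φ)).comp τ (zero_add _) ≠ 0 := by
    intro h
    refine hf ((Ext.mk₀_eq_zero_iff _).1 ((hτ W hW' 0 _ (zero_add _)).1 (h.trans ?_)))
    exact (Ext.zero_comp W 0 τ _ (zero_add _)).symm
  obtain ⟨L, _, hL, ε, hε⟩ := exists_ext_comp_ne_zero d W hW hWdim _ _ hg
  have hε' : ε.comp (Ext.mk₀ f) (add_zero d) ≠ 0 := by
    intro h
    refine hε _ rfl ?_
    rw [← Ext.comp_assoc_of_second_deg_zero, ← Ext.mk₀_comp_mk₀,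
      ← Ext.comp_assoc_of_third_deg_zero, h, Ext.zero_comp, Ext.zero_comp]
  by_contra hc
  rw [not_nontrivial_iff_subsingleton] at hc
  have := subsingleton_ext_of_supportDim_le_zero hc L hL
  exact hε' (Subsingleton.elim _ _)

/-! ### Local cohomology -/

/-- Composition of morphisms `L ⟶ N` with a fixed extension class of `N`. -/
noncomputable def homCompExt {N Y : ModuleCat.{u} R} {c : ℕ} (τ : Ext N Y c) (L : ModuleCat.{u} R) :
    (L ⟶ N) →ₗ[R] Ext L Y c where
  toFun f := (Ext.mk₀ f).comp τ (zero_add c)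
  map_add' f g := by rw [Ext.mk₀_add, Ext.add_comp]
  map_smul' r f := by rw [Ext.mk₀_smul, Ext.smul_comp]; rfl

/-- If all classes in `Ext L Y c` are uniquely of the form `f ∘ τ`, this is the map
`f ∘ τ ↦ f x`. -/
noncomputable def evalExt {N Y : ModuleCat.{u} R} {c : ℕ} {τ : Ext N Y c} {L : ModuleCat.{u} R}
    (h : Function.Bijective (homCompExt τ L)) (x : L) : Ext L Y c →ₗ[R] N :=
  (LinearMap.applyₗ x ∘ₗ (homLinearEquiv (S := R)).toLinearMap) ∘ₗ
    (LinearEquiv.ofBijective _ h).symm.toLinearMap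

section

variable {N Y : ModuleCat.{u} R} {c : ℕ} {τ : Ext N Y c} {L L' : ModuleCat.{u} R}
  (h : Function.Bijective (homCompExt τ L)) (h' : Function.Bijective (homCompExt τ L'))

lemma evalExt_homCompExt (x : L) (f : L ⟶ N) : evalExt h x (homCompExt τ L f) = f.hom x :=
  congrArg (fun g : L ⟶ N ↦ g.hom x) ((LinearEquiv.ofBijective _ h).symm_apply_apply f)

lemma evalExt_mk₀_comp (p : L ⟶ L') (x : L) (α : Ext L' Y c) :
    evalExt h x ((Ext.mk₀ p).comp α (zero_add c)) = evalExt h' (p.hom x) α := by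
  obtain ⟨f, rfl⟩ := h'.2 α
  have : (Ext.mk₀ p).comp (homCompExt τ L' f) (zero_add c) = homCompExt τ L (p ≫ f) := by
    simp [homCompExt]
  rw [this, evalExt_homCompExt, evalExt_homCompExt]
  rfl

lemma precompExt_comp_evalExt (p : L ⟶ L') {x : L} {x' : L'} (hp : p.hom x = x') :
    ProjectiveResolution.precompExt R Y p c ≫ ofHom (evalExt h x) = ofHom (evalExt h' x') :=
  hom_ext (LinearMap.ext fun α ↦ (evalExt_mk₀_comp h h' p x α).trans (by rw [hp]; rfl))

end

lemma eq_zero_of_evalExt_one_eq_zero {I : Ideal R} {N Y : ModuleCat.{u} R} {c : ℕ} {τ : Ext N Y c}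
    (h : Function.Bijective (homCompExt τ (of R (R ⧸ I)))) {α : Ext (of R (R ⧸ I)) Y c}
    (hα : evalExt h (1 : R ⧸ I) α = 0) : α = 0 := by
  obtain ⟨f, rfl⟩ := h.2 α
  rw [quotient_hom_eq_zero ((evalExt_homCompExt h _ f).symm.trans hα), map_zero]

open localCohomology in
lemma exists_comp_eq_evalExt (I : Ideal R) {N Y : ModuleCat.{u} R} {c : ℕ} {τ : Ext N Y c}
    (hτ : ∀ t : ℕ, Function.Bijective (homCompExt τ (of R (R ⧸ I ^ t)))) (t : ℕ) :
    ∃ (φ : (localCohomology I c).obj Y ⟶ N)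
      (j : of R (Ext (of R (R ⧸ I ^ t)) Y c) ⟶ (localCohomology I c).obj Y),
      j ≫ φ = ofHom (evalExt (hτ t) (1 : R ⧸ I ^ t)) := by
  let D := diagram (idealPowersDiagram I) c
  let ev := (evaluation (ModuleCat.{u} R) (ModuleCat.{u} R)).obj Y
  have : Limits.HasColimit D := hasColimitDiagram.{u, 0} _ _
  let hc : Limits.IsColimit (ev.mapCocone (Limits.colimit.cocone D)) :=
    Limits.isColimitOfPreserves ev (Limits.colimit.isColimit D)
  let θ (t : ℕ) : Ext (of R (R ⧸ I ^ t)) Y c →ₗ[R] N :=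
    evalExt (hτ t) (1 : R ⧸ I ^ t)
  let s : Limits.Cocone (D ⋙ ev) :=
    { pt := N
      ι :=
        { app t := (ProjectiveResolution.extIso R (of R (R ⧸ I ^ t.unop.unop)) Y c).hom ≫
            ofHom (θ t.unop.unop)
          naturality t t' w := by
            let p := (ringModIdeals (idealPowersDiagram I)).map w.unop
            have hp : p.hom (1 : R ⧸ I ^ t'.unop.unop) =
                (1 : R ⧸ I ^ t.unop.unop) := rfl
            have key := precompExt_comp_evalExt (hτ t'.unop.unop) (hτ t.unop.unop) p hp
            refine Eq.trans ?_ (Category.comp_id _).symm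
            refine Eq.trans ((reassoc_of% (ProjectiveResolution.map_extIso_hom R Y p c)) _) ?_
            exact congrArg _ key } }
  let e := ProjectiveResolution.extIso R (of R (R ⧸ I ^ t)) Y c
  have fac : (ev.mapCocone (Limits.colimit.cocone D)).ι.app (.op (.op t)) ≫ hc.desc s =
      e.hom ≫ ofHom (θ t) := hc.fac s (.op (.op t))
  generalize hc.desc s = φ at fac
  generalize (ev.mapCocone (Limits.colimit.cocone D)).ι.app (.op (.op t)) = ι at fac
  refine ⟨φ, e.inv ≫ ι, ?_⟩
  exact (Category.assoc _ _ _).trans ((congrArg (e.inv ≫ ·) fac).trans (e.inv_hom_id_assoc _))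

/-- If `Ext c (R ⧸ I) Y` is nonzero and represented by a class `τ : Ext N Y c`, then the natural map
from the local cohomology of `Y` to `N` is nonzero on some element killed by `I`. -/
theorem exists_localCohomology_hom (I : Ideal R) {N Y : ModuleCat.{u} R} {c : ℕ} {τ : Ext N Y c}
    (hτ : ∀ t : ℕ, Function.Bijective (homCompExt τ (of R (R ⧸ I ^ t))))
    (hne : Nontrivial (Ext (of R (R ⧸ I)) Y c)) :
    ∃ (φ : (localCohomology I c).obj Y ⟶ N) (m : (localCohomology I c).obj Y),
      (∀ x ∈ I, x • m = 0) ∧ φ.hom m ≠ 0 := by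
  obtain ⟨φ, j, hj⟩ := exists_comp_eq_evalExt I hτ 1
  have h1 : Nontrivial (Ext (of R (R ⧸ I ^ 1)) Y c) := by rwa [pow_one]
  obtain ⟨α, hα⟩ := exists_ne (0 : Ext (of R (R ⧸ I ^ 1)) Y c)
  refine ⟨φ, j.hom α, fun x hx ↦ ?_, fun h0 ↦ ?_⟩
  · rw [← map_smul, smul_ext_eq_zero (smul_quotient_eq_zero (by rwa [pow_one])) α, map_zero]
  · have h2 : φ.hom (j.hom α) = evalExt (hτ 1) (1 : R ⧸ I ^ 1) α := congrArg (fun q ↦ q.hom α) hj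
    exact hα (eq_zero_of_evalExt_one_eq_zero (hτ 1) (h2.symm.trans h0))

/-- The nonvanishing of the highest Lyubeznik number over a local Cohen–Macaulay ring. -/
theorem nontrivial_ext_residue_localCohomology [IsNoetherianRing R] [IsLocalRing R] {n d : ℕ}
    (hn : (n : WithBot ℕ∞) = ringKrullDim R)
    (hR : ∀ i < n, Subsingleton (Ext (of R (R ⧸ IsLocalRing.maximalIdeal R)) (of R R) i))
    {I : Ideal R} (hI : I ≠ ⊤) (hd : (d : WithBot ℕ∞) = ringKrullDim (R ⧸ I)) :
    Nontrivial (Ext (of R (R ⧸ IsLocalRing.maximalIdeal R))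
      ((localCohomology I (n - d)).obj (of R R)) d) := by
  obtain ⟨xs, hlen, hxI, hreg, hne⟩ := exists_isRegular_of_cohenMacaulay hn hR hI hd
  obtain ⟨N, τ, -, hτ⟩ := exists_ext_comp_bijective (of R R) xs hreg.toIsWeaklyRegular _ rfl
  have hbij (t : ℕ) : Function.Bijective (homCompExt τ (of R (R ⧸ I ^ t))) := by
    refine (hτ _ (fun x hx ↦ ⟨t, fun l ↦ smul_quotient_eq_zero (Ideal.pow_mem_pow (hxI x hx) t) l⟩)
      0 _ (zero_add _)).comp (Ext.mk₀_bijective _ _)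
  obtain ⟨φ, m, hm, hφ⟩ := exists_localCohomology_hom I hbij hne
  rw [← Nat.eq_sub_of_add_eq hlen]
  rw [add_comm] at hlen
  exact nontrivial_ext_residue hreg (hlen ▸ hn) (hlen ▸ hR) hτ φ m (fun x hx ↦ hm x (hxI x hx)) hφ

end ModuleCat

/-- **Lyubeznik.** Let `(R, 𝔪, k)` be a Noetherian regular local ring containing a field
(regularity: `𝔪` is generated by `dim R = n` elements), let `I` be a proper ideal and
`d = dim (R/I)`.  Then the highest Lyubeznik number is positive:
`Ext^d_R(k, H^{n-d}_I(R)) ≠ 0`. -/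
theorem lyubeznik_highest_number_positive
    (R : Type) [CommRing R] [IsNoetherianRing R] [IsLocalRing R]
    (hreg : ∃ s : Finset R, Ideal.span (s : Set R) = IsLocalRing.maximalIdeal R ∧
      (s.card : WithBot ℕ∞) = ringKrullDim R)
    (F : Type) [Field F] [Algebra F R]
    (I : Ideal R) (hI : I ≠ ⊤)
    (n d : ℕ) (hn : (n : WithBot ℕ∞) = ringKrullDim R)
    (hd : (d : WithBot ℕ∞) = ringKrullDim (R ⧸ I)) :
    Nontrivial (((Ext R (ModuleCat R) d).obj
        (Opposite.op (ModuleCat.of R (R ⧸ IsLocalRing.maximalIdeal R)))).obj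
      ((localCohomology I (n - d)).obj (ModuleCat.of R R))) := by
  obtain ⟨s, hs, hcard⟩ := hreg
  have hsn : s.card = n := by exact_mod_cast hcard.trans hn.symm
  have := ModuleCat.nontrivial_ext_residue_localCohomology hn
    (hsn ▸ ModuleCat.subsingleton_ext_residue_of_regular s hs hcard) hI hd
  exact (ProjectiveResolution.extIso R _ _ d).toLinearEquiv.toEquiv.nontrivial
end
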